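/- Rearrangement inequality for Gaussian-convolved random walks: Let A be a symmetric positive definite d×d real matrix, b ∈ ℝ^d, t > 0, and set A* = (det A)^{1/d} I_d. Define f_{A,b}(t,x) = (2πt)^{-d/2}(det A)^{-1/2} exp(−⟨x − tb, A⁻¹(x − tb)⟩/(2t)). Let φ : ℝ^d → [0,∞) be measurable and vanishing at infinity, let f₁,…,f_m : ℝ^d → [0,∞) be continuous functions vanishing at infinity, let 0 ≤ k₁ ≤ ⋯ ≤ k_m be integers, and let x ∈ ℝ^d. Then ∫_{(ℝ^d)^{k_m+1}} ∏_{i=1}^m f_i(x₀ + x₁ + ⋯ + x_{k_i}) · f_{A,b}(t, x₀ − x) · ∏_{j=1}^{k_m} φ(x_j) dx₀ dx₁⋯dx_{k_m} ≤ ∫_{(ℝ^d)^{k_m+1}} ∏_{i=1}^m f_i*(x₀ + x₁ + ⋯ + x_{k_i}) · f_{A*,0}(t, x₀) · ∏_{j=1}^{k_m} φ*(x_j) dx₀ dx₁⋯dx_{k_m}, where an empty sum of the x_j's (j ≥ 1) is understood to be 0 and both integrals are taken in [0,∞]. -/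

import Mathlib

open MeasureTheory ENNReal Filter Topology
open scoped RealInnerProductSpace

/-- A nonnegative function on `ℝ^d` vanishes at infinity if all its positive
super-level sets have finite Lebesgue measure. -/
def VanishesAtInfinity {d : ℕ} (f : EuclideanSpace ℝ (Fin d) → ℝ) : Prop :=
  ∀ t : ℝ, 0 < t → volume {x : EuclideanSpace ℝ (Fin d) | t < f x} < ⊤

/-- Radius of the ball centered at the origin having the same volume as `A`. -/
noncomputable def symmRadius {d : ℕ} (A : Set (EuclideanSpace ℝ (Fin d))) : ℝ :=
  ((volume A / volume (Metric.ball (0 : EuclideanSpace ℝ (Fin d)) 1)).toReal) ^ ((1 : ℝ) / d)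

/-- `A*`: the open ball centered at the origin with the same Lebesgue measure as `A`. -/
noncomputable def ballStar {d : ℕ} (A : Set (EuclideanSpace ℝ (Fin d))) :
    Set (EuclideanSpace ℝ (Fin d)) :=
  Metric.ball 0 (symmRadius A)

/-- Symmetric decreasing rearrangement `f*` (with values in `[0,∞]`):
`f*(x) = ∫₀^∞ 1_{{f>t}*}(x) dt`. -/
noncomputable def symmRearrange {d : ℕ} (f : EuclideanSpace ℝ (Fin d) → ℝ)
    (x : EuclideanSpace ℝ (Fin d)) : ℝ≥0∞ :=
  ∫⁻ t in Set.Ioi (0 : ℝ), (ballStar {y | t < f y}).indicator (fun _ => (1 : ℝ≥0∞)) x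

/-- `x₁ + ⋯ + x_n` for a configuration `x` (indices shifted by one: `x j` is `x_{j+1}`);
an empty sum is `0`. -/
noncomputable def partialSum {d K : ℕ} (x : Fin K → EuclideanSpace ℝ (Fin d)) (n : ℕ) :
    EuclideanSpace ℝ (Fin d) :=
  ∑ j : Fin K, if (j : ℕ) < n then x j else 0

/-- The quadratic form `⟨x, M x⟩` of a `d × d` matrix. -/
noncomputable def quadForm {d : ℕ} (M : Matrix (Fin d) (Fin d) ℝ)
    (x : EuclideanSpace ℝ (Fin d)) : ℝ :=
  ∑ i, ∑ j, x i * M i j * x j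

/-- The nondegenerate Gaussian density
`f_{A,b}(t,x) = (2πt)^{-d/2} (det A)^{-1/2} exp(-⟨x-tb, A⁻¹(x-tb)⟩/(2t))`. -/
noncomputable def gaussDensity {d : ℕ} (A : Matrix (Fin d) (Fin d) ℝ)
    (b : EuclideanSpace ℝ (Fin d)) (t : ℝ) (x : EuclideanSpace ℝ (Fin d)) : ℝ :=
  (2 * Real.pi * t) ^ (-(d : ℝ) / 2) * (Real.sqrt A.det)⁻¹ *
    Real.exp (-(quadForm A⁻¹ (x - t • b)) / (2 * t))

/-- The symmetrized Gaussian density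
`f_{A*,0}(t,x) = (2πt)^{-d/2} (det A)^{-1/2} exp(-|x|²/(2t (det A)^{1/d}))`,
where `A* = (det A)^{1/d} I_d`. -/
noncomputable def gaussStarDensity {d : ℕ} (A : Matrix (Fin d) (Fin d) ℝ) (t : ℝ)
    (x : EuclideanSpace ℝ (Fin d)) : ℝ :=
  (2 * Real.pi * t) ^ (-(d : ℝ) / 2) * (Real.sqrt A.det)⁻¹ *
    Real.exp (-(‖x‖ ^ 2) / (2 * t * A.det ^ ((1 : ℝ) / d)))

/-- The Riesz functional `∬ 1_A(x) 1_B(y) 1_C(x + y) dx dy`. -/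
noncomputable def rieszFunctional {V : Type*} [MeasureSpace V] [Add V] (A B C : Set V) : ℝ≥0∞ :=
  (volume.prod volume) {p : V × V | p.1 ∈ A ∧ p.2 ∈ B ∧ p.1 + p.2 ∈ C}

theorem indicator_one_congr {α β : Type*} {s : Set α} {t : Set β} {a : α} {b : β}
    (h : a ∈ s ↔ b ∈ t) : s.indicator (1 : α → ℝ≥0∞) a = t.indicator 1 b := by
  classical
  simp [Set.indicator_apply, h]

section RieszFunctional

variable {V : Type*} [AddCommGroup V] [MeasureSpace V] [MeasurableAdd₂ V] [MeasurableNeg V]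
  [SFinite (volume : Measure V)] [(volume : Measure V).IsAddLeftInvariant]

theorem lintegral_lintegral_eq_antidiagonal {F : V → V → ℝ≥0∞}
    (hF : Measurable (Function.uncurry F)) :
    ∫⁻ r, ∫⁻ s, F r s = ∫⁻ x, ∫⁻ r, F r (x - r) := by
  have : ∀ r, ∫⁻ s, F r s = ∫⁻ x, F r (x - r) := fun r =>
    (lintegral_sub_right_eq_self (F r) r).symm
  simp_rw [this]
  refine lintegral_lintegral_swap (Measurable.aemeasurable ?_)
  exact hF.comp (measurable_fst.prodMk (measurable_snd.sub measurable_fst))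

variable {A B C : Set V}

omit [MeasurableNeg V] [SFinite (volume : Measure V)]
  [(volume : Measure V).IsAddLeftInvariant] in
theorem measurableSet_rieszRegion (hA : MeasurableSet A) (hB : MeasurableSet B)
    (hC : MeasurableSet C) :
    MeasurableSet {p : V × V | p.1 ∈ A ∧ p.2 ∈ B ∧ p.1 + p.2 ∈ C} :=
  (measurable_fst hA).inter ((measurable_snd hB).inter ((measurable_fst.add measurable_snd) hC))

omit [MeasurableAdd₂ V] [MeasurableNeg V] [SFinite (volume : Measure V)]
  [(volume : Measure V).IsAddLeftInvariant] in
theorem rieszFunctional_mono {A' B' C' : Set V} (hA : A ⊆ A') (hB : B ⊆ B') (hC : C ⊆ C') :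
    rieszFunctional A B C ≤ rieszFunctional A' B' C' :=
  measure_mono fun _ h => ⟨hA h.1, hB h.2.1, hC h.2.2⟩

omit [MeasurableNeg V] [(volume : Measure V).IsAddLeftInvariant] in
theorem rieszFunctional_comm (hA : MeasurableSet A) (hB : MeasurableSet B)
    (hC : MeasurableSet C) : rieszFunctional A B C = rieszFunctional B A C := by
  unfold rieszFunctional
  conv_lhs => rw [← Measure.prod_swap,
    Measure.map_apply measurable_swap (measurableSet_rieszRegion hA hB hC)]
  refine congrArg _ (Set.ext fun p => ?_)
  exact ⟨fun h => ⟨h.2.1, h.1, by simpa [add_comm] using h.2.2⟩,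
    fun h => ⟨h.2.1, h.1, by simpa [add_comm] using h.2.2⟩⟩

omit [MeasurableAdd₂ V] [MeasurableNeg V] [(volume : Measure V).IsAddLeftInvariant] in
theorem rieszFunctional_le_mul : rieszFunctional A B C ≤ volume A * volume B := by
  rw [← Measure.prod_prod]
  exact measure_mono fun _ h => ⟨h.1, h.2.1⟩

theorem rieszFunctional_eq_setLIntegral (hA : MeasurableSet A) (hB : MeasurableSet B)
    (hC : MeasurableSet C) :
    rieszFunctional A B C = ∫⁻ x in C, volume {r | r ∈ A ∧ x - r ∈ B} := by
  have hZ := measurableSet_rieszRegion hA hB hC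
  have h1 : ∀ x, MeasurableSet {r | r ∈ A ∧ x - r ∈ B} := fun x =>
    hA.inter ((measurable_const.sub measurable_id) hB)
  rw [rieszFunctional, ← lintegral_indicator_one hZ, lintegral_prod _
    (measurable_one.indicator hZ).aemeasurable,
    lintegral_lintegral_eq_antidiagonal (F := fun r s => Set.indicator _ 1 (r, s))
      (measurable_one.indicator hZ), ← lintegral_indicator hC]
  refine lintegral_congr fun x => ?_
  by_cases hx : x ∈ C
  · rw [Set.indicator_of_mem hx, ← lintegral_indicator_one (h1 x)]
    refine lintegral_congr fun r => ?_
    exact indicator_one_congr (by simp [hx])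
  · rw [Set.indicator_of_notMem hx]
    refine (lintegral_congr fun r => Set.indicator_of_notMem ?_ _).trans lintegral_zero
    simp [hx]

theorem rieszFunctional_le_mul' (hA : MeasurableSet A) (hB : MeasurableSet B)
    (hC : MeasurableSet C) : rieszFunctional A B C ≤ volume A * volume C := by
  rw [rieszFunctional_eq_setLIntegral hA hB hC, ← setLIntegral_const]
  exact lintegral_mono fun x => measure_mono fun r hr => hr.1

end RieszFunctional

section OneDim

theorem exists_measure_Iio_eq (ν : Measure ℝ) [IsFiniteMeasure ν] [NullSingletonClass ν] {s : ℝ≥0∞}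
    (h0 : 0 < s) (h1 : s < ν Set.univ) : ∃ y, ν (Set.Iio y) = s := by
  have key : ∀ (l : Filter ℝ) [l.IsCountablyGenerated] (U : Set ℝ), MeasurableSet U →
      (∀ᵐ x ∂ν, Tendsto (fun y => (Set.Iio y).indicator (1 : ℝ → ℝ≥0∞) x) l
        (𝓝 (U.indicator 1 x))) → Tendsto (fun y => ν (Set.Iio y)) l (𝓝 (ν U)) := by
    intro l _ U hU h
    simp_rw [← lintegral_indicator_one hU, ← fun y : ℝ => lintegral_indicator_one (μ := ν)
      (measurableSet_Iio (a := y))]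
    refine tendsto_lintegral_filter_of_dominated_convergence 1
      (.of_forall fun y => measurable_one.indicator measurableSet_Iio) (.of_forall fun y =>
        .of_forall fun x => Set.indicator_le_self _ _ x) (by simp) h
  have hcont : Continuous fun y => ν (Set.Iio y) := by
    rw [continuous_iff_continuousAt]
    intro y
    refine key (𝓝 y) _ measurableSet_Iio ?_
    have : ∀ᵐ x ∂ν, x ≠ y := by simp [ae_iff]
    filter_upwards [this] with x hx
    rcases lt_or_gt_of_ne hx with h | h
    · refine tendsto_const_nhds.congr' ?_
      filter_upwards [Ioi_mem_nhds h] with z hz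
      rw [Set.indicator_of_mem (Set.mem_Iio.2 h), Set.indicator_of_mem (Set.mem_Iio.2 hz)]
    · refine tendsto_const_nhds.congr' ?_
      filter_upwards [Iio_mem_nhds h] with z hz
      rw [Set.indicator_of_notMem (by simpa using h.le),
        Set.indicator_of_notMem (by simpa using (Set.mem_Iio.1 hz).le)]
  have hbot : Tendsto (fun y => ν (Set.Iio y)) atBot (𝓝 (ν ∅)) := by
    refine key atBot _ .empty (.of_forall fun x => tendsto_const_nhds.congr' ?_)
    filter_upwards [eventually_le_atBot x] with z hz
    rw [Set.indicator_of_notMem (by simp), Set.indicator_of_notMem (by simpa using hz)]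
  have htop : Tendsto (fun y => ν (Set.Iio y)) atTop (𝓝 (ν Set.univ)) := by
    refine key atTop _ .univ (.of_forall fun x => tendsto_const_nhds.congr' ?_)
    filter_upwards [eventually_gt_atTop x] with z hz
    rw [Set.indicator_of_mem (by simp), Set.indicator_of_mem (by simpa using hz)]
  rw [measure_empty] at hbot
  exact mem_range_of_exists_le_of_exists_ge hcont
    ((hbot.eventually_lt_const h0).exists.imp fun _ h => h.le)
    ((htop.eventually_const_lt h1).exists.imp fun _ h => h.le)

/-- The open interval centered at `0` of length `a`. -/
def centeredInterval (a : ℝ) : Set ℝ := Set.Ioo (-(a / 2)) (a / 2)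

theorem volume_centeredInterval (a : ℝ) : volume (centeredInterval a) = ENNReal.ofReal a := by
  rw [centeredInterval, Real.volume_Ioo]; congr 1; ring

theorem measurableSet_centeredInterval (a : ℝ) : MeasurableSet (centeredInterval a) :=
  measurableSet_Ioo

theorem volume_corner_le {a b c : ℝ} (h1 : c - b ≤ a) :
    (volume.prod volume) {p : ℝ × ℝ | p.1 < a / 2 ∧ p.2 < b / 2 ∧ c / 2 ≤ p.1 + p.2} ≤
      ENNReal.ofReal (((a + b - c) / 2) ^ 2 / 2) := by
  have hm : MeasurableSet {p : ℝ × ℝ | p.1 < a / 2 ∧ p.2 < b / 2 ∧ c / 2 ≤ p.1 + p.2} := by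
    refine (measurableSet_lt measurable_fst measurable_const).inter
      ((measurableSet_lt measurable_snd measurable_const).inter
        (measurableSet_le measurable_const (measurable_fst.add measurable_snd)))
  rw [Measure.prod_apply hm]
  have hle : ∀ r : ℝ, volume (Prod.mk r ⁻¹'
      {p : ℝ × ℝ | p.1 < a / 2 ∧ p.2 < b / 2 ∧ c / 2 ≤ p.1 + p.2}) ≤
      (Set.Ioc ((c - b) / 2) (a / 2)).indicator
        (fun r => ENNReal.ofReal (r - (c - b) / 2)) r := by
    intro r
    by_cases hr : r ∈ Set.Ioc ((c - b) / 2) (a / 2)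
    · rw [Set.indicator_of_mem hr]
      refine (measure_mono (t := Set.Ico (c / 2 - r) (b / 2)) ?_).trans ?_
      · rintro t ⟨-, h2, h3⟩
        exact ⟨by simp only at h3; linarith, h2⟩
      · rw [Real.volume_Ico]
        exact ENNReal.ofReal_le_ofReal (by linarith)
    · rw [Set.indicator_of_notMem hr]
      refine le_of_eq (measure_mono_null (t := ∅) ?_ measure_empty)
      rintro t ⟨h1, h2, h3⟩
      simp only at h1 h2 h3
      exact hr ⟨by linarith, h1.le⟩
  refine (lintegral_mono hle).trans ?_
  rw [lintegral_indicator measurableSet_Ioc, ← ofReal_integral_eq_lintegral_ofReal]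
  · rw [← intervalIntegral.integral_of_le (by linarith)]
    refine ENNReal.ofReal_le_ofReal (le_of_eq ?_)
    rw [intervalIntegral.integral_sub (by simp) (by simp), integral_id,
      intervalIntegral.integral_const, smul_eq_mul]
    ring
  · exact (Continuous.intervalIntegrable (by fun_prop) _ _).1
  · filter_upwards [ae_restrict_mem measurableSet_Ioc] with r hr
    simpa using hr.1.le

theorem le_rieszFunctional_centeredInterval {a b c : ℝ} (hc : c ≤ a + b) :
    ENNReal.ofReal a * ENNReal.ofReal b ≤
      rieszFunctional (centeredInterval a) (centeredInterval b) (centeredInterval c) +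
        ENNReal.ofReal (((a + b - c) / 2) ^ 2) := by
  set U := {p : ℝ × ℝ | p.1 < a / 2 ∧ p.2 < b / 2 ∧ c / 2 ≤ p.1 + p.2}
  have hU : (volume.prod volume) U ≤ _ := volume_corner_le (by linarith)
  have hsub : centeredInterval a ×ˢ centeredInterval b ⊆
      {p : ℝ × ℝ | p.1 ∈ centeredInterval a ∧ p.2 ∈ centeredInterval b ∧
        p.1 + p.2 ∈ centeredInterval c} ∪ (U ∪ Neg.neg ⁻¹' U) := by
    rintro ⟨r, t⟩ ⟨hr, ht⟩
    by_cases h : r + t ∈ centeredInterval c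
    · exact .inl ⟨hr, ht, h⟩
    · simp only [centeredInterval, Set.mem_Ioo, not_and_or, not_lt] at h hr ht
      right
      rcases h with h | h
      · refine .inr ⟨?_, ?_, ?_⟩ <;> simp only [Prod.fst_neg, Prod.snd_neg] <;> linarith
      · exact .inl ⟨hr.2, ht.2, h⟩
  calc _ = (volume.prod volume) (centeredInterval a ×ˢ centeredInterval b) := by
        rw [Measure.prod_prod, volume_centeredInterval, volume_centeredInterval]
    _ ≤ _ := (measure_mono hsub).trans (measure_union_le _ _)
    _ ≤ _ := by
        refine add_le_add le_rfl ((measure_union_le _ _).trans ?_)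
        rw [Measure.measure_preimage_neg]
        refine (add_le_add hU hU).trans ?_
        rw [← ENNReal.ofReal_add (by positivity) (by positivity)]
        exact ENNReal.ofReal_le_ofReal (by linarith)

/-- The key one-dimensional estimate: cutting off a piece of `A` on the left and a piece of `B` on
the right, the remaining pairs are estimated trivially. -/
theorem rieszFunctional_le_cut {A B C : Set ℝ} (hA : MeasurableSet A) (hB : MeasurableSet B)
    (hC : MeasurableSet C) (y z : ℝ) :
    rieszFunctional A B C ≤ volume (A ∩ Set.Ici y) * volume (B ∩ Set.Iic z) +
      max (volume (A ∩ Set.Iio y)) (volume (B ∩ Set.Ioi z)) * volume C := by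
  set R := {p : ℝ × ℝ | p.1 ∈ A ∧ p.2 ∈ B ∧ p.1 + p.2 ∈ C}
  have hR : MeasurableSet R := measurableSet_rieszRegion hA hB hC
  set Z := R ∩ (Prod.fst ⁻¹' Set.Iio y ∪ Prod.snd ⁻¹' Set.Ioi z)
  have hZ : MeasurableSet Z :=
    hR.inter ((measurable_fst measurableSet_Iio).union (measurable_snd measurableSet_Ioi))
  have hsub : R ⊆ (A ∩ Set.Ici y) ×ˢ (B ∩ Set.Iic z) ∪ Z := by
    rintro ⟨r, t⟩ h
    by_cases h1 : r < y ∨ z < t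
    · exact .inr ⟨h, h1⟩
    · push Not at h1
      exact .inl ⟨⟨h.1, h1.1⟩, ⟨h.2.1, h1.2⟩⟩
  refine (measure_mono hsub).trans ((measure_union_le _ _).trans ?_)
  rw [Measure.prod_prod]
  refine add_le_add le_rfl ?_
  rw [← lintegral_indicator_one hZ, lintegral_prod _ (measurable_one.indicator hZ).aemeasurable,
    lintegral_lintegral_eq_antidiagonal (F := fun r s => Set.indicator _ 1 (r, s))
      (measurable_one.indicator hZ), ← setLIntegral_const, ← lintegral_indicator hC]
  refine lintegral_mono fun x => ?_
  have hm : MeasurableSet {r | (r, x - r) ∈ Z} :=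
    (measurable_id.prodMk (measurable_const.sub measurable_id)) hZ
  have : ∫⁻ r, Z.indicator 1 (r, x - r) = volume {r | (r, x - r) ∈ Z} := by
    rw [← lintegral_indicator_one hm]; rfl
  simp only [this]
  by_cases hx : x ∈ C
  · rw [Set.indicator_of_mem hx]
    rcases le_total y (x - z) with h | h
    · refine le_max_of_le_right ?_
      have h2 : volume ((fun r => x - r) ⁻¹' (B ∩ Set.Ioi z)) = volume (B ∩ Set.Ioi z) :=
        (Measure.measurePreserving_sub_left volume x).measure_preimage
          (hB.inter measurableSet_Ioi).nullMeasurableSet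
      rw [← h2]
      refine measure_mono ?_
      rintro r ⟨hr, h1⟩
      refine ⟨hr.2.1, ?_⟩
      rcases h1 with h1 | h1
      · simp only [Set.mem_preimage, Set.mem_Iio] at h1
        simp only [Set.mem_Ioi]; linarith
      · exact h1
    · refine le_max_of_le_left (measure_mono ?_)
      rintro r ⟨hr, h1⟩
      refine ⟨hr.1, ?_⟩
      rcases h1 with h1 | h1
      · exact h1
      · simp only [Set.mem_preimage, Set.mem_Ioi] at h1
        simp only [Set.mem_Iio]; linarith
  · rw [Set.indicator_of_notMem hx]
    refine le_of_eq (measure_mono_null (t := ∅) ?_ measure_empty)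
    rintro r ⟨hr, -⟩
    exact hx (by simpa using hr.2.2)

theorem exists_volume_inter_Iio_eq {A : Set ℝ} {a s : ℝ}
    (hvol : volume A = ENNReal.ofReal a) (h0 : 0 < s) (h1 : s < a) :
    ∃ y, volume (A ∩ Set.Iio y) = ENNReal.ofReal s ∧
      volume (A ∩ Set.Ici y) = ENNReal.ofReal (a - s) := by
  have : IsFiniteMeasure (volume.restrict A) := ⟨by simp [hvol]⟩
  obtain ⟨y, hy⟩ := exists_measure_Iio_eq (volume.restrict A) (s := ENNReal.ofReal s)
    (by simpa) (by rw [Measure.restrict_apply_univ, hvol]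
                   exact (ENNReal.ofReal_lt_ofReal_iff (h0.trans h1)).2 h1)
  rw [Measure.restrict_apply measurableSet_Iio, Set.inter_comm] at hy
  refine ⟨y, hy, ?_⟩
  have h2 := measure_inter_add_sdiff (μ := volume) A (measurableSet_Iio (a := y))
  rw [hy, hvol, Set.sdiff_eq, Set.compl_Iio] at h2
  rw [ENNReal.ofReal_sub _ h0.le, ← h2, ENNReal.add_sub_cancel_left ENNReal.ofReal_ne_top]

theorem exists_volume_inter_Ioi_eq {A : Set ℝ} {a s : ℝ}
    (hvol : volume A = ENNReal.ofReal a) (h0 : 0 < s) (h1 : s < a) :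
    ∃ y, volume (A ∩ Set.Ioi y) = ENNReal.ofReal s ∧
      volume (A ∩ Set.Iic y) = ENNReal.ofReal (a - s) := by
  obtain ⟨y, h2, h3⟩ := exists_volume_inter_Iio_eq (A := Neg.neg ⁻¹' A)
    (by rwa [Measure.measure_preimage_neg]) h0 h1
  refine ⟨-y, ?_, ?_⟩
  · rw [← h2, ← Measure.measure_preimage_neg, Set.preimage_inter, Set.neg_preimage, Set.neg_preimage,
      Set.neg_Ioi, neg_neg]
  · rw [← h3, ← Measure.measure_preimage_neg, Set.preimage_inter, Set.neg_preimage, Set.neg_preimage,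
      Set.neg_Iic, neg_neg]

theorem mul_le_rieszFunctional_centeredInterval {a b c : ℝ} (h : a + c ≤ b) :
    ENNReal.ofReal a * ENNReal.ofReal c ≤
      rieszFunctional (centeredInterval a) (centeredInterval b) (centeredInterval c) := by
  rw [rieszFunctional_eq_setLIntegral (measurableSet_centeredInterval _)
    (measurableSet_centeredInterval _) (measurableSet_centeredInterval _),
    ← volume_centeredInterval a, ← volume_centeredInterval c, ← setLIntegral_const]
  refine setLIntegral_mono' (measurableSet_centeredInterval _) fun x hx => measure_mono fun r hr =>
    ⟨hr, ?_⟩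
  simp only [centeredInterval, Set.mem_Ioo] at hx hr ⊢
  constructor <;> linarith

/-- Riesz's rearrangement inequality for sets on the line. -/
theorem rieszFunctional_le_centeredInterval {A B C : Set ℝ} (hA : MeasurableSet A)
    (hB : MeasurableSet B) (hC : MeasurableSet C) {a b c : ℝ} (ha : 0 ≤ a)
    (hc : 0 ≤ c) (hvA : volume A = ENNReal.ofReal a) (hvB : volume B = ENNReal.ofReal b)
    (hvC : volume C = ENNReal.ofReal c) :
    rieszFunctional A B C ≤
      rieszFunctional (centeredInterval a) (centeredInterval b) (centeredInterval c) := by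
  rcases le_or_gt (a + b) c with h1 | h1
  · refine rieszFunctional_le_mul.trans (le_of_eq ?_)
    rw [hvA, hvB, ← volume_centeredInterval a, ← volume_centeredInterval b, ← Measure.prod_prod]
    congr 1
    ext ⟨r, t⟩
    simp only [Set.mem_prod, Set.mem_ofPred_eq]
    refine ⟨fun h => ⟨h.1, h.2, ?_⟩, fun h => ⟨h.1, h.2.1⟩⟩
    simp only [centeredInterval, Set.mem_Ioo] at h ⊢
    constructor <;> linarith
  rcases le_or_gt (a + c) b with h2 | h2
  · refine (rieszFunctional_le_mul' hA hB hC).trans ?_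
    rw [hvA, hvC]
    exact mul_le_rieszFunctional_centeredInterval h2
  rcases le_or_gt (b + c) a with h3 | h3
  · rw [rieszFunctional_comm hA hB hC, rieszFunctional_comm (measurableSet_centeredInterval _)
      (measurableSet_centeredInterval _) (measurableSet_centeredInterval _)]
    refine (rieszFunctional_le_mul' hB hA hC).trans ?_
    rw [hvB, hvC]
    exact mul_le_rieszFunctional_centeredInterval h3
  set s := (a + b - c) / 2
  obtain ⟨y, hy1, hy2⟩ := exists_volume_inter_Iio_eq hvA (s := s) (by simp only [s]; linarith)
    (by simp only [s]; linarith)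
  obtain ⟨z, hz1, hz2⟩ := exists_volume_inter_Ioi_eq hvB (s := s) (by simp only [s]; linarith)
    (by simp only [s]; linarith)
  have h5 := rieszFunctional_le_cut hA hB hC y z
  rw [hy1, hy2, hz1, hz2, max_self, hvC] at h5
  refine h5.trans ?_
  have h6 := le_rieszFunctional_centeredInterval (b := b) h1.le
  refine (ENNReal.add_le_add_iff_right (a := ENNReal.ofReal (s ^ 2)) ENNReal.ofReal_ne_top).1
    (le_trans (le_of_eq ?_) h6)
  have hs0 : 0 ≤ s := by simp only [s]; linarith
  have hsa : 0 ≤ a - s := by simp only [s]; linarith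
  have hsb : 0 ≤ b - s := by simp only [s]; linarith
  rw [← ENNReal.ofReal_mul hsa, ← ENNReal.ofReal_mul hs0, ← ENNReal.ofReal_mul ha,
    ← ENNReal.ofReal_add (by positivity) (by positivity),
    ← ENNReal.ofReal_add (by positivity) (by positivity)]
  congr 1
  simp only [s]
  ring

end OneDim

theorem rieszFunctional_preimage_add_right {V : Type*} [AddCommGroup V] [MeasureSpace V]
    [MeasurableAdd₂ V] [SFinite (volume : Measure V)] [(volume : Measure V).IsAddRightInvariant]
    {A B C : Set V} (hA : MeasurableSet A) (hB : MeasurableSet B) (hC : MeasurableSet C) (α β : V) :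
    rieszFunctional ((· + α) ⁻¹' A) ((· + β) ⁻¹' B) ((· + (α + β)) ⁻¹' C) =
      rieszFunctional A B C := by
  rw [rieszFunctional, rieszFunctional, ← ((measurePreserving_add_right volume α).prod
    (measurePreserving_add_right volume β)).measure_preimage
    (measurableSet_rieszRegion hA hB hC).nullMeasurableSet]
  refine congrArg _ (Set.ext fun p => ?_)
  simp only [Set.mem_preimage, Set.mem_ofPred_eq, Prod.map_fst, Prod.map_snd]
  rw [add_add_add_comm]

section Steiner

variable {V : Type*} [NormedAddCommGroup V] [InnerProductSpace ℝ V]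

/-- The length of the intersection of `A` with the line through `x` in direction `e`. -/
noncomputable def lineLength (e : V) (A : Set V) (x : V) : ℝ≥0∞ :=
  volume {r : ℝ | x + r • e ∈ A}

/-- Steiner symmetrization of `A` in direction `e`. -/
def steiner (e : V) (A : Set V) : Set V :=
  {x | ENNReal.ofReal (2 * |⟪e, x⟫|) < lineLength e A x}

/-- The slab orthogonal to `e` of width one. -/
def slab (e : V) : Set V := {x | ⟪e, x⟫ ∈ Set.Ico (0 : ℝ) 1}

theorem lineLength_add_smul (e : V) (A : Set V) (x : V) (r : ℝ) :
    lineLength e A (x + r • e) = lineLength e A x := by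
  unfold lineLength
  rw [← measure_preimage_add volume r {s : ℝ | x + s • e ∈ A}]
  simp [add_smul, add_assoc]

theorem lineLength_mono {e : V} {A B : Set V} (h : A ⊆ B) (x : V) :
    lineLength e A x ≤ lineLength e B x :=
  measure_mono fun _ hr => h hr

theorem steiner_mono {e : V} {A B : Set V} (h : A ⊆ B) : steiner e A ⊆ steiner e B :=
  fun x hx => lt_of_lt_of_le hx (lineLength_mono h x)

variable {e : V} (he : ‖e‖ = 1)
include he

theorem inner_add_smul_self (x : V) (r : ℝ) : ⟪e, x + r • e⟫ = r + ⟪e, x⟫ := by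
  rw [inner_add_right, real_inner_smul_right, real_inner_self_eq_norm_sq, he]
  ring

theorem mem_steiner_add_smul {A : Set V} {x : V} {a : ℝ}
    (hxa : lineLength e A x = ENNReal.ofReal a) :
    {r : ℝ | x + r • e ∈ steiner e A} = (· + ⟪e, x⟫) ⁻¹' centeredInterval a := by
  ext r
  simp only [steiner, Set.mem_ofPred_eq, Set.mem_preimage, lineLength_add_smul, hxa,
    inner_add_smul_self he, centeredInterval, Set.mem_Ioo, ← abs_lt]
  rw [ENNReal.ofReal_lt_ofReal_iff']
  constructor
  · intro h; linarith [h.1]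
  · intro h
    have := abs_nonneg (r + ⟪e, x⟫)
    constructor <;> linarith

theorem lineLength_steiner {A : Set V} {x : V} (h : lineLength e A x ≠ ∞) :
    lineLength e (steiner e A) x = lineLength e A x := by
  have h1 := ENNReal.ofReal_toReal h
  rw [lineLength, mem_steiner_add_smul he h1.symm, measure_preimage_add_right,
    volume_centeredInterval, h1]

theorem lineLength_le_of_subset_ball {A : Set V} {R : ℝ} (hA : A ⊆ Metric.ball 0 R) (x : V) :
    lineLength e A x ≤ ENNReal.ofReal (2 * R) := by
  have : {r : ℝ | x + r • e ∈ A} ⊆ (· + ⟪e, x⟫) ⁻¹' centeredInterval (2 * R) := by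
    intro r hr
    have h1 : ‖x + r • e‖ < R := by simpa using hA hr
    have h2 := abs_real_inner_le_norm e (x + r • e)
    rw [inner_add_smul_self he, he, one_mul] at h2
    simp only [centeredInterval, Set.mem_preimage, Set.mem_Ioo, ← abs_lt]
    linarith
  refine (measure_mono this).trans ?_
  rw [measure_preimage_add_right, volume_centeredInterval]

theorem lineLength_ball (x : V) (ρ : ℝ) :
    lineLength e (Metric.ball 0 ρ) x =
      ENNReal.ofReal (if 0 < ρ then 2 * √(ρ ^ 2 - ‖x‖ ^ 2 + ⟪e, x⟫ ^ 2) else 0) := by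
  split_ifs with hρ
  · have : {r : ℝ | x + r • e ∈ Metric.ball (0 : V) ρ} =
        (· + ⟪e, x⟫) ⁻¹' centeredInterval (2 * √(ρ ^ 2 - ‖x‖ ^ 2 + ⟪e, x⟫ ^ 2)) := by
      ext r
      have h1 : ‖x + r • e‖ ^ 2 = (r + ⟪e, x⟫) ^ 2 + (‖x‖ ^ 2 - ⟪e, x⟫ ^ 2) := by
        rw [norm_add_sq_real, norm_smul, he, real_inner_smul_right, real_inner_comm,
          Real.norm_eq_abs, mul_one, sq_abs]
        ring
      simp only [centeredInterval, Set.mem_preimage, Set.mem_Ioo, ← abs_lt, Set.mem_ofPred_eq,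
        mem_ball_zero_iff, mul_div_cancel_left₀ _ (two_ne_zero (α := ℝ))]
      rw [Real.lt_sqrt (abs_nonneg _), sq_abs,
        ← sq_lt_sq₀ (norm_nonneg _) hρ.le, h1]
      constructor <;> intro h <;> linarith
    rw [lineLength, this, measure_preimage_add_right, volume_centeredInterval]
  · simp [lineLength, Metric.ball_eq_empty.2 (not_lt.1 hρ)]

theorem steiner_ball (ρ : ℝ) : steiner e (Metric.ball 0 ρ) = Metric.ball 0 ρ := by
  ext x
  simp only [steiner, Set.mem_ofPred_eq, lineLength_ball he, mem_ball_zero_iff]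
  rw [ENNReal.ofReal_lt_ofReal_iff']
  split_ifs with hρ
  · have h1 : 2 * |⟪e, x⟫| < 2 * √(ρ ^ 2 - ‖x‖ ^ 2 + ⟪e, x⟫ ^ 2) ↔ ‖x‖ < ρ := by
      rw [mul_lt_mul_iff_right₀ two_pos, Real.lt_sqrt (abs_nonneg _), sq_abs,
        ← sq_lt_sq₀ (norm_nonneg _) hρ.le]
      constructor <;> intro h <;> linarith
    rw [h1, and_iff_left_iff_imp]
    intro h
    exact lt_of_le_of_lt (by positivity) (h1.2 h)
  · simp only [lt_self_iff_false, and_false, false_iff, not_lt]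
    exact (not_lt.1 hρ).trans (norm_nonneg x)

variable [MeasureSpace V] [BorelSpace V] [FiniteDimensional ℝ V]

omit he in
theorem measurable_lineLength {A : Set V} (hA : MeasurableSet A) :
    Measurable fun p : V × V => lineLength p.1 A p.2 := by
  have : MeasurableSet {q : (V × V) × ℝ | q.1.2 + q.2 • q.1.1 ∈ A} :=
    (show Measurable fun q : (V × V) × ℝ => q.1.2 + q.2 • q.1.1 by fun_prop) hA
  exact measurable_measure_prodMk_left this

omit he in
theorem measurableSet_steiner {A : Set V} (hA : MeasurableSet A) :
    MeasurableSet (steiner e A) := by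
  refine measurableSet_lt (by fun_prop) ?_
  exact (measurable_lineLength hA).comp (measurable_const.prodMk measurable_id)

omit he in
theorem measurableSet_slab : MeasurableSet (slab e) := by
  have : Measurable fun x : V => ⟪e, x⟫ := by fun_prop
  exact this measurableSet_Ico

variable [(volume : Measure V).IsAddHaarMeasure]

/-- Fubini's theorem along the lines in direction `e`. -/
theorem setLIntegral_slab {F : V → ℝ≥0∞} (hF : Measurable F) :
    ∫⁻ x in slab e, ∫⁻ r : ℝ, F (x + r • e) = ∫⁻ x, F x := by
  have hs : Measurable ((slab e).indicator (1 : V → ℝ≥0∞)) :=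
    measurable_one.indicator measurableSet_slab
  calc _ = ∫⁻ x, ∫⁻ r : ℝ, (slab e).indicator 1 x * F (x + r • e) := by
        rw [← lintegral_indicator measurableSet_slab]
        refine lintegral_congr fun x => ?_
        by_cases hx : x ∈ slab e <;> simp [hx]
    _ = ∫⁻ r : ℝ, ∫⁻ x, (slab e).indicator 1 x * F (x + r • e) := by
        refine lintegral_lintegral_swap (Measurable.aemeasurable ?_)
        exact (hs.comp measurable_fst).mul (hF.comp (by fun_prop))
    _ = ∫⁻ r : ℝ, ∫⁻ x, (slab e).indicator 1 (x - r • e) * F x := by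
        refine lintegral_congr fun r => ?_
        rw [← lintegral_sub_right_eq_self _ (r • e)]
        simp
    _ = ∫⁻ x, ∫⁻ r : ℝ, (slab e).indicator 1 (x - r • e) * F x := by
        refine lintegral_lintegral_swap (Measurable.aemeasurable ?_)
        exact (hs.comp (by fun_prop)).mul (hF.comp measurable_snd)
    _ = _ := by
        refine lintegral_congr fun x => ?_
        rw [lintegral_mul_const _ (show Measurable fun r : ℝ =>
          (slab e).indicator (1 : V → ℝ≥0∞) (x - r • e) from hs.comp (by fun_prop))]
        have : ∀ r : ℝ, (slab e).indicator (1 : V → ℝ≥0∞) (x - r • e) =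
            (Set.Ioc (⟪e, x⟫ - 1) ⟪e, x⟫).indicator 1 r := by
          intro r
          refine indicator_one_congr ?_
          rw [sub_eq_add_neg, ← neg_smul]
          simp only [slab, Set.mem_ofPred_eq, inner_add_smul_self he, Set.mem_Ico, Set.mem_Ioc]
          constructor <;> rintro ⟨h1, h2⟩ <;> constructor <;> linarith
        simp_rw [this]
        rw [lintegral_indicator_one measurableSet_Ioc]
        simp

theorem setLIntegral_slab_lineLength {A : Set V} (hA : MeasurableSet A) :
    ∫⁻ x in slab e, lineLength e A x = volume A := by
  rw [← lintegral_indicator_one hA, ← setLIntegral_slab he (measurable_one.indicator hA)]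
  refine lintegral_congr fun x => ?_
  have : MeasurableSet {r : ℝ | x + r • e ∈ A} :=
    (show Measurable fun r : ℝ => x + r • e by fun_prop) hA
  rw [lineLength, ← lintegral_indicator_one this]
  rfl

theorem volume_steiner {A : Set V} (hA : MeasurableSet A) {R : ℝ}
    (hR : A ⊆ Metric.ball 0 R) : volume (steiner e A) = volume A := by
  rw [← setLIntegral_slab_lineLength he hA,
    ← setLIntegral_slab_lineLength he (measurableSet_steiner hA)]
  exact lintegral_congr fun x => lineLength_steiner he
    (ne_top_of_le_ne_top ofReal_ne_top (lineLength_le_of_subset_ball he hR x))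

theorem rieszFunctional_eq_slab {A B C : Set V} (hA : MeasurableSet A) (hB : MeasurableSet B)
    (hC : MeasurableSet C) :
    rieszFunctional A B C = ∫⁻ x in slab e, ∫⁻ y in slab e,
      rieszFunctional {r : ℝ | x + r • e ∈ A} {r : ℝ | y + r • e ∈ B}
        {r : ℝ | x + y + r • e ∈ C} := by
  set Z := {p : V × V | p.1 ∈ A ∧ p.2 ∈ B ∧ p.1 + p.2 ∈ C}
  have hZ : MeasurableSet Z := measurableSet_rieszRegion hA hB hC
  have hf : Measurable (Z.indicator (1 : V × V → ℝ≥0∞)) := measurable_one.indicator hZ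
  rw [rieszFunctional, ← lintegral_indicator_one hZ, lintegral_prod _ hf.aemeasurable,
    ← setLIntegral_slab he hf.lintegral_prod_right']
  refine lintegral_congr fun x => ?_
  have h1 : ∀ r : ℝ, ∫⁻ y, Z.indicator 1 (x + r • e, y) =
      ∫⁻ y in slab e, ∫⁻ s : ℝ, Z.indicator 1 (x + r • e, y + s • e) := fun r =>
    (setLIntegral_slab he (hf.comp (measurable_const.prodMk measurable_id))).symm
  simp_rw [h1]
  have h2 : Measurable fun q : (ℝ × V) × ℝ =>
      Z.indicator (1 : V × V → ℝ≥0∞) (x + q.1.1 • e, q.1.2 + q.2 • e) :=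
    hf.comp (by fun_prop)
  rw [lintegral_lintegral_swap h2.lintegral_prod_right'.aemeasurable]
  refine lintegral_congr fun y => ?_
  have hm : ∀ (z : V) {S : Set V}, MeasurableSet S → MeasurableSet {r : ℝ | z + r • e ∈ S} :=
    fun z S hS => (show Measurable fun r : ℝ => z + r • e by fun_prop) hS
  have hR := measurableSet_rieszRegion (hm x hA) (hm y hB) (hm (x + y) hC)
  rw [rieszFunctional, ← lintegral_indicator_one hR, lintegral_prod _
    (measurable_one.indicator hR).aemeasurable]
  refine lintegral_congr fun r => lintegral_congr fun s => indicator_one_congr ?_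
  simp only [Z, Set.mem_ofPred_eq]
  rw [add_add_add_comm, add_smul]

theorem rieszFunctional_le_steiner {A B C : Set V} (hA : MeasurableSet A) (hB : MeasurableSet B)
    (hC : MeasurableSet C) {R : ℝ} (hAR : A ⊆ Metric.ball 0 R) (hBR : B ⊆ Metric.ball 0 R)
    (hCR : C ⊆ Metric.ball 0 R) :
    rieszFunctional A B C ≤ rieszFunctional (steiner e A) (steiner e B) (steiner e C) := by
  rw [rieszFunctional_eq_slab he hA hB hC, rieszFunctional_eq_slab he (measurableSet_steiner hA)
    (measurableSet_steiner hB) (measurableSet_steiner hC)]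
  refine lintegral_mono fun x => lintegral_mono fun y => ?_
  have hm : ∀ (z : V) {S : Set V}, MeasurableSet S → MeasurableSet {r : ℝ | z + r • e ∈ S} :=
    fun z S hS => (show Measurable fun r : ℝ => z + r • e by fun_prop) hS
  have hl : ∀ {S : Set V} (z : V), S ⊆ Metric.ball 0 R →
      lineLength e S z = ENNReal.ofReal (lineLength e S z).toReal := fun z hS =>
    (ENNReal.ofReal_toReal (ne_top_of_le_ne_top ofReal_ne_top
      (lineLength_le_of_subset_ball he hS z))).symm
  rw [mem_steiner_add_smul he (hl x hAR), mem_steiner_add_smul he (hl y hBR),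
    mem_steiner_add_smul he (hl (x + y) hCR), inner_add_right,
    rieszFunctional_preimage_add_right (measurableSet_centeredInterval _)
      (measurableSet_centeredInterval _) (measurableSet_centeredInterval _)]
  exact rieszFunctional_le_centeredInterval (hm _ hA) (hm _ hB) (hm _ hC) toReal_nonneg
    toReal_nonneg (hl x hAR) (hl y hBR) (hl _ hCR)

/-- Symmetrization decreases the part of `A` outside a centered ball. -/
theorem volume_steiner_sdiff_ball {A : Set V} (hA : MeasurableSet A) {R ρ : ℝ}
    (hR : A ⊆ Metric.ball 0 R) :
    volume (steiner e A \ Metric.ball 0 ρ) +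
        ∫⁻ x in slab e, min (lineLength e (A \ Metric.ball 0 ρ) x)
          (lineLength e (Metric.ball 0 ρ \ A) x) ≤ volume (A \ Metric.ball 0 ρ) := by
  set B := Metric.ball (0 : V) ρ
  have hB : MeasurableSet B := measurableSet_ball
  have hSA : MeasurableSet (steiner e A) := measurableSet_steiner hA
  have hmL : ∀ {S : Set V}, MeasurableSet S → Measurable (lineLength e S) := fun hS =>
    (measurable_lineLength hS).comp (measurable_const.prodMk measurable_id)
  rw [← setLIntegral_slab_lineLength he (hSA.diff hB),
    ← setLIntegral_slab_lineLength he (hA.diff hB), ← lintegral_add_left (hmL (hSA.diff hB))]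
  refine lintegral_mono fun x => ?_
  have hm : ∀ {S : Set V}, MeasurableSet S → MeasurableSet {r : ℝ | x + r • e ∈ S} :=
    fun hS => (show Measurable fun r : ℝ => x + r • e by fun_prop) hS
  have hfA : lineLength e A x ≠ ∞ :=
    ne_top_of_le_ne_top ofReal_ne_top (lineLength_le_of_subset_ball he hR x)
  have hfB : lineLength e B x ≠ ∞ :=
    ne_top_of_le_ne_top ofReal_ne_top (lineLength_le_of_subset_ball he subset_rfl x)
  have hsplit : ∀ {S T : Set V}, MeasurableSet T →
      lineLength e (S ∩ T) x + lineLength e (S \ T) x = lineLength e S x := fun hT =>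
    measure_inter_add_sdiff _ (hm hT)
  have hcompare := le_total (lineLength e A x) (lineLength e B x)
  have hbase : ∀ {S T : Set V}, lineLength e S x ≤ lineLength e T x →
      lineLength e (steiner e S \ steiner e T) x = 0 := by
    intro S T h
    refine measure_mono_null (t := ∅) ?_ measure_empty
    rintro r ⟨h1, h2⟩
    have h3 : lineLength e S (x + r • e) ≤ lineLength e T (x + r • e) := by
      rwa [lineLength_add_smul, lineLength_add_smul]
    exact h2 (lt_of_lt_of_le h1 h3)
  have hstB : steiner e B = B := steiner_ball he ρ
  rcases hcompare with h | h
  · have := hbase h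
    rw [hstB] at this
    simp only [this, zero_add]
    exact min_le_left _ _
  · have h0 := hbase h
    rw [hstB] at h0
    have h1 := hsplit (S := steiner e A) (T := B) hB
    have h2 := hsplit (S := B) (T := steiner e A) hSA
    have h3 := hsplit (S := A) (T := B) hB
    have h4 := hsplit (S := B) (T := A) hA
    rw [h0, add_zero, Set.inter_comm] at h2
    rw [lineLength_steiner he hfA, h2, ← h3, ← h4, Set.inter_comm B A, add_assoc] at h1
    have hfin : lineLength e (A ∩ B) x ≠ ∞ :=
      ne_top_of_le_ne_top hfA (lineLength_mono Set.inter_subset_left x)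
    have h5 := (ENNReal.add_right_inj hfin).1 h1
    rw [← h5, add_comm]
    exact add_le_add (min_le_right _ _) le_rfl

theorem setLIntegral_lineLength_eq {P Q : Set V} (hP : MeasurableSet P) (hQ : MeasurableSet Q) :
    ∫⁻ x in P, lineLength e Q x = ∫⁻ x in slab e, lineLength e P x * lineLength e Q x := by
  have hmQ : Measurable (lineLength e Q) :=
    (measurable_lineLength hQ).comp (measurable_const.prodMk measurable_id)
  have hm1 : Measurable (P.indicator (1 : V → ℝ≥0∞)) := measurable_one.indicator hP
  have : ∫⁻ x in P, lineLength e Q x = ∫⁻ x, P.indicator 1 x * lineLength e Q x := by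
    rw [← lintegral_indicator hP]
    refine lintegral_congr fun x => ?_
    by_cases hx : x ∈ P <;> simp [hx]
  rw [this, ← setLIntegral_slab he (F := fun x => P.indicator 1 x * lineLength e Q x)
    (hm1.mul hmQ)]
  refine lintegral_congr fun x => ?_
  simp_rw [lineLength_add_smul]
  rw [lintegral_mul_const _ (show Measurable fun r : ℝ =>
    P.indicator (1 : V → ℝ≥0∞) (x + r • e) from hm1.comp (by fun_prop))]
  congr 1
  have : MeasurableSet {r : ℝ | x + r • e ∈ P} :=
    (show Measurable fun r : ℝ => x + r • e by fun_prop) hP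
  rw [lineLength, ← lintegral_indicator_one this]
  rfl

theorem setLIntegral_lineLength_le {P Q : Set V} (hP : MeasurableSet P) (hQ : MeasurableSet Q)
    {R : ℝ} (hPR : P ⊆ Metric.ball 0 R) (hQR : Q ⊆ Metric.ball 0 R) :
    ∫⁻ x in P, lineLength e Q x ≤
      ENNReal.ofReal (2 * R) * ∫⁻ x in slab e, min (lineLength e P x) (lineLength e Q x) := by
  rw [setLIntegral_lineLength_eq he hP hQ, ← lintegral_const_mul' _ _ ofReal_ne_top]
  refine lintegral_mono fun x => ?_
  rw [← max_mul_min]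
  exact mul_le_mul_left (max_le (lineLength_le_of_subset_ball he hPR x)
    (lineLength_le_of_subset_ball he hQR x)) _

end Steiner

section Averaging

variable {V : Type*} [NormedAddCommGroup V] [InnerProductSpace ℝ V] [MeasureSpace V]
  [BorelSpace V] [FiniteDimensional ℝ V] [(volume : Measure V).IsAddHaarMeasure] [Nontrivial V]

theorem lintegral_eq_lintegral_sphere {F : V → ℝ≥0∞} (hF : Measurable F) :
    ∫⁻ x, F x = ∫⁻ e : Metric.sphere (0 : V) 1, ∫⁻ r in Set.Ioi (0 : ℝ),
      ENNReal.ofReal (r ^ (Module.finrank ℝ V - 1)) * F (r • (e : V))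
        ∂volume ∂(volume : Measure V).toSphere := by
  have h1 := (volume : Measure V).measurePreserving_homeomorphUnitSphereProd.symm
    (homeomorphUnitSphereProd V).toMeasurableEquiv
  have hF' : Measurable fun x : ({0}ᶜ : Set V) => F (x : V) := hF.comp measurable_subtype_coe
  calc ∫⁻ x, F x = ∫⁻ x : ({0}ᶜ : Set V), F (x : V) ∂(volume.comap Subtype.val) := by
        rw [lintegral_subtype_comap (measurableSet_singleton _).compl, restrict_compl_singleton]
    _ = ∫⁻ p : Metric.sphere (0 : V) 1 × Set.Ioi (0 : ℝ), F (p.2.1 • (p.1 : V))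
        ∂((volume : Measure V).toSphere.prod (.volumeIoiPow (Module.finrank ℝ V - 1))) := by
        rw [← h1.lintegral_comp hF']
        rfl
    _ = _ := by
        rw [lintegral_prod _ (show Measurable fun p : Metric.sphere (0 : V) 1 × Set.Ioi (0 : ℝ) =>
          F ((p.2 : ℝ) • (p.1 : V)) from hF.comp (by fun_prop)).aemeasurable]
        refine lintegral_congr fun e => ?_
        rw [Measure.volumeIoiPow, lintegral_withDensity_eq_lintegral_mul _ (by fun_prop)
          (show Measurable fun r : Set.Ioi (0 : ℝ) => F ((r : ℝ) • (e : V)) from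
            hF.comp (by fun_prop))]
        exact lintegral_subtype_comap measurableSet_Ioi
          fun r : ℝ => ENNReal.ofReal (r ^ (Module.finrank ℝ V - 1)) * F (r • (e : V))

theorem volume_le_lintegral_lineLength {Q : Set V} (hQ : MeasurableSet Q) {R : ℝ}
    (hQR : Q ⊆ Metric.ball 0 R) {x : V} (hx : ‖x‖ ≤ R) :
    volume Q ≤ ENNReal.ofReal ((2 * R) ^ (Module.finrank ℝ V - 1)) *
      ∫⁻ e : Metric.sphere (0 : V) 1, lineLength (e : V) Q x ∂(volume : Measure V).toSphere := by
  have h1 : volume Q = volume ((x + ·) ⁻¹' Q) := (measure_preimage_add volume x Q).symm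
  have hm : MeasurableSet ((x + ·) ⁻¹' Q) := measurable_const_add x hQ
  rw [h1, ← lintegral_indicator_one hm, lintegral_eq_lintegral_sphere
    (measurable_one.indicator hm), ← lintegral_const_mul' _ _ ofReal_ne_top]
  refine lintegral_mono fun e => ?_
  have he : ‖(e : V)‖ = 1 := by simp
  have hm2 : MeasurableSet {r : ℝ | x + r • (e : V) ∈ Q} :=
    (show Measurable fun r : ℝ => x + r • (e : V) by fun_prop) hQ
  rw [lineLength, ← lintegral_indicator_one hm2, ← lintegral_const_mul' _ _ ofReal_ne_top]
  refine (setLIntegral_mono' measurableSet_Ioi fun r hr => ?_).trans (setLIntegral_le_lintegral _ _)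
  by_cases hr2 : x + r • (e : V) ∈ Q
  · rw [Set.indicator_of_mem (show r • (e : V) ∈ (x + ·) ⁻¹' Q from hr2),
      Set.indicator_of_mem (show r ∈ {r : ℝ | x + r • (e : V) ∈ Q} from hr2)]
    simp only [Pi.one_apply, mul_one]
    refine ENNReal.ofReal_le_ofReal (pow_le_pow_left₀ (le_of_lt hr) ?_ _)
    have h3 : ‖x + r • (e : V)‖ < R := by simpa using hQR hr2
    have h4 : ‖r • (e : V)‖ = r := by rw [norm_smul, he, mul_one, Real.norm_of_nonneg (le_of_lt hr)]
    have h5 := norm_sub_le (x + r • (e : V)) x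
    rw [add_sub_cancel_left, h4] at h5
    linarith
  · rw [Set.indicator_of_notMem (show r • (e : V) ∉ (x + ·) ⁻¹' Q from hr2)]
    simp

theorem exists_mul_volume_le_setLIntegral_lineLength (R : ℝ) :
    ∃ K : ℝ≥0∞, K ≠ 0 ∧ ∀ P Q : Set V, MeasurableSet P → MeasurableSet Q →
      P ⊆ Metric.ball 0 R → Q ⊆ Metric.ball 0 R →
      ∃ e : V, ‖e‖ = 1 ∧ K * (volume P * volume Q) ≤ ∫⁻ x in P, lineLength e Q x := by
  set c := ENNReal.ofReal ((2 * R) ^ (Module.finrank ℝ V - 1))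
  set σ := (volume : Measure V).toSphere
  have hσ : σ ≠ 0 := Measure.toSphere_ne_zero _
  have hσ1 : σ Set.univ ≠ ∞ := measure_ne_top _ _
  have hσ0 : σ Set.univ ≠ 0 := by simpa using hσ
  have hc : c ≠ ∞ := ofReal_ne_top
  refine ⟨(c * σ Set.univ)⁻¹, ENNReal.inv_ne_zero.2 (ENNReal.mul_ne_top hc hσ1),
    fun P Q hP hQ hPR hQR => ?_⟩
  have hmL : Measurable fun p : Metric.sphere (0 : V) 1 × V => lineLength (p.1 : V) Q p.2 :=
    (measurable_lineLength hQ).comp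
      ((measurable_subtype_coe.comp measurable_fst).prodMk measurable_snd)
  have hPfin : volume P ≠ ∞ :=
    ne_top_of_le_ne_top measure_ball_lt_top.ne (measure_mono hPR)
  have hbound : ∀ e : Metric.sphere (0 : V) 1,
      ∫⁻ x in P, lineLength (e : V) Q x ≤ ENNReal.ofReal (2 * R) * volume P := by
    intro e
    rw [← setLIntegral_const]
    exact lintegral_mono fun x => lineLength_le_of_subset_ball (by simp) hQR x
  have hfin : ∫⁻ e : Metric.sphere (0 : V) 1, (∫⁻ x in P, lineLength (e : V) Q x) ∂σ ≠ ∞ := by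
    refine ne_top_of_le_ne_top ?_ (lintegral_mono hbound)
    rw [lintegral_const]
    exact ENNReal.mul_ne_top (ENNReal.mul_ne_top ofReal_ne_top hPfin) hσ1
  obtain ⟨e, he⟩ := exists_laverage_le hσ hfin
  refine ⟨e, by simp, le_trans ?_ he⟩
  rw [laverage_eq, ENNReal.mul_inv (.inr hσ1) (.inl hc), mul_comm c⁻¹, mul_assoc, div_eq_mul_inv,
    mul_comm _ (σ Set.univ)⁻¹]
  gcongr
  rw [lintegral_lintegral_swap hmL.aemeasurable]
  have h1 : volume P * volume Q ≤
      c * ∫⁻ x in P, ∫⁻ e : Metric.sphere (0 : V) 1, lineLength (e : V) Q x ∂σ := by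
    rw [← lintegral_const_mul' _ _ hc, mul_comm, ← setLIntegral_const]
    refine setLIntegral_mono' hP fun x hx => volume_le_lintegral_lineLength hQ hQR ?_
    exact (mem_ball_zero_iff.1 (hPR hx)).le
  rcases eq_or_ne c 0 with h0 | h0
  · rw [h0, zero_mul, nonpos_iff_eq_zero] at h1
    simp [h1]
  · rw [mul_comm, ← div_eq_mul_inv]
    exact ENNReal.div_le_of_le_mul' h1

theorem exists_steiner_gain {R : ℝ} (hR : 0 < R) :
    ∃ K : ℝ≥0∞, K ≠ 0 ∧ ∀ (A : Set V) (ρ : ℝ), MeasurableSet A → A ⊆ Metric.ball 0 R → ρ ≤ R →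
      ∃ e : V, ‖e‖ = 1 ∧ volume (steiner e A \ Metric.ball 0 ρ) +
        K * (volume (A \ Metric.ball 0 ρ) * volume (Metric.ball 0 ρ \ A)) ≤
          volume (A \ Metric.ball 0 ρ) := by
  obtain ⟨K, hK, h⟩ := exists_mul_volume_le_setLIntegral_lineLength (V := V) R
  have hR0 : ENNReal.ofReal (2 * R) ≠ 0 := by simpa using hR
  refine ⟨(ENNReal.ofReal (2 * R))⁻¹ * K, mul_ne_zero (ENNReal.inv_ne_zero.2 ofReal_ne_top) hK,
    fun A ρ hA hAR hρ => ?_⟩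
  have hP : A \ Metric.ball 0 ρ ⊆ Metric.ball 0 R := Set.sdiff_subset.trans hAR
  have hQ : Metric.ball 0 ρ \ A ⊆ Metric.ball 0 R :=
    Set.sdiff_subset.trans (Metric.ball_subset_ball hρ)
  have hPm := hA.diff (measurableSet_ball (x := (0 : V)) (ε := ρ))
  have hQm := (measurableSet_ball (x := (0 : V)) (ε := ρ)).diff hA
  obtain ⟨e, he, h1⟩ := h _ _ hPm hQm hP hQ
  refine ⟨e, he, le_trans (add_le_add le_rfl ?_) (volume_steiner_sdiff_ball he hA hAR)⟩
  rw [mul_assoc, mul_comm, ← div_eq_mul_inv]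
  exact ENNReal.div_le_of_le_mul' (h1.trans (setLIntegral_lineLength_le he hPm hQm hP hQ))

end Averaging

section BallStar

variable {d : ℕ}

theorem symmRadius_nonneg (A : Set (EuclideanSpace ℝ (Fin d))) : 0 ≤ symmRadius A :=
  Real.rpow_nonneg toReal_nonneg _

theorem measurableSet_ballStar (A : Set (EuclideanSpace ℝ (Fin d))) :
    MeasurableSet (ballStar A) :=
  measurableSet_ball

variable [NeZero d]

theorem volume_ball_zero {r : ℝ} (hr : 0 ≤ r) :
    volume (Metric.ball (0 : EuclideanSpace ℝ (Fin d)) r) =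
      ENNReal.ofReal (r ^ d) * volume (Metric.ball (0 : EuclideanSpace ℝ (Fin d)) 1) := by
  rw [Measure.addHaar_ball _ _ hr, finrank_euclideanSpace_fin]

theorem volume_ball_lt_volume_ball {r s : ℝ} (hr : 0 ≤ r) (h : r < s) :
    volume (Metric.ball (0 : EuclideanSpace ℝ (Fin d)) r) <
      volume (Metric.ball (0 : EuclideanSpace ℝ (Fin d)) s) := by
  rw [volume_ball_zero hr, volume_ball_zero (hr.trans h.le)]
  refine ENNReal.mul_lt_mul_left (Metric.measure_ball_pos _ _ one_pos).ne'
    measure_ball_lt_top.ne ?_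
  rw [ENNReal.ofReal_lt_ofReal_iff (pow_pos (hr.trans_lt h) _)]
  exact pow_lt_pow_left₀ h hr (NeZero.ne d)

theorem volume_ballStar {A : Set (EuclideanSpace ℝ (Fin d))} (h : volume A ≠ ∞) :
    volume (ballStar A) = volume A := by
  have hd : (d : ℝ) ≠ 0 := Nat.cast_ne_zero.2 (NeZero.ne d)
  have h0 := (Metric.measure_ball_pos volume (0 : EuclideanSpace ℝ (Fin d)) one_pos).ne'
  have h1 := (measure_ball_lt_top (μ := volume) (x := (0 : EuclideanSpace ℝ (Fin d)))
    (r := 1)).ne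
  rw [ballStar, volume_ball_zero (symmRadius_nonneg A), symmRadius, ← Real.rpow_mul_natCast
    toReal_nonneg, one_div_mul_cancel hd, Real.rpow_one,
    ENNReal.ofReal_toReal (ENNReal.div_ne_top h h0), ENNReal.div_mul_cancel h0 h1]

/-- A centered ball is contained in every radial set of at least the same measure. -/
theorem ballStar_subset_of_volume_le {S B : Set (EuclideanSpace ℝ (Fin d))}
    (hB : ∀ x y, ‖x‖ ≤ ‖y‖ → y ∈ B → x ∈ B) (hS : volume S ≠ ∞) (h : volume S ≤ volume B) :
    ballStar S ⊆ B := by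
  intro x hx
  by_contra hxB
  have h1 : B ⊆ Metric.ball 0 ‖x‖ := fun y hy => by
    rw [mem_ball_zero_iff]
    by_contra! h2
    exact hxB (hB x y h2 hy)
  have h2 := volume_ball_lt_volume_ball (d := d) (norm_nonneg x) (mem_ball_zero_iff.1 hx)
  rw [← ballStar, volume_ballStar hS] at h2
  exact absurd (h.trans (measure_mono h1)) (not_le.2 h2)

theorem ballStar_mono {S T : Set (EuclideanSpace ℝ (Fin d))} (hT : volume T ≠ ∞)
    (h : volume S ≤ volume T) : ballStar S ⊆ ballStar T := by
  refine ballStar_subset_of_volume_le (fun x y hxy hy => ?_) (ne_top_of_le_ne_top hT h)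
    (by rwa [volume_ballStar hT])
  rw [ballStar, mem_ball_zero_iff] at hy ⊢
  exact hxy.trans_lt hy

theorem symmRadius_le_of_subset_ball {S : Set (EuclideanSpace ℝ (Fin d))} {R : ℝ} (hR : 0 ≤ R)
    (h : S ⊆ Metric.ball 0 R) : symmRadius S ≤ R := by
  by_contra! h1
  have h2 := volume_ball_lt_volume_ball (d := d) hR h1
  have h3 := measure_mono (μ := volume) h
  rw [← ballStar, volume_ballStar (ne_top_of_le_ne_top measure_ball_lt_top.ne h3)] at h2
  exact absurd h3 (not_le.2 h2)

end BallStar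

section Riesz

variable {d : ℕ} [NeZero d]

/-- Repeated Steiner symmetrization brings three bounded sets close to centered balls. -/
theorem exists_rieszFunctional_le_near_ballStar {S : Fin 3 → Set (EuclideanSpace ℝ (Fin d))}
    (hS : ∀ i, MeasurableSet (S i)) {R : ℝ} (hR : 0 < R) (hSR : ∀ i, S i ⊆ Metric.ball 0 R)
    {δ : ℝ≥0∞} (hδ : δ ≠ 0) :
    ∃ T : Fin 3 → Set (EuclideanSpace ℝ (Fin d)), (∀ i, MeasurableSet (T i)) ∧
      (∀ i, T i ⊆ Metric.ball 0 R) ∧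
      rieszFunctional (S 0) (S 1) (S 2) ≤ rieszFunctional (T 0) (T 1) (T 2) ∧
      ∀ i, volume (T i \ ballStar (S i)) < δ := by
  obtain ⟨K, hK, hgain⟩ := exists_steiner_gain (V := EuclideanSpace ℝ (Fin d)) hR
  by_contra! hcon
  have hfinR : ∀ {A : Set (EuclideanSpace ℝ (Fin d))}, A ⊆ Metric.ball 0 R → volume A ≠ ∞ :=
    fun h => ne_top_of_le_ne_top measure_ball_lt_top.ne (measure_mono h)
  have iterate : ∀ n : ℕ, ∃ T : Fin 3 → Set (EuclideanSpace ℝ (Fin d)),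
      (∀ i, MeasurableSet (T i)) ∧ (∀ i, T i ⊆ Metric.ball 0 R) ∧
      rieszFunctional (S 0) (S 1) (S 2) ≤ rieszFunctional (T 0) (T 1) (T 2) ∧
      (∀ i, volume (T i) = volume (S i)) ∧
      ∑ i, volume (T i \ ballStar (S i)) + n * (K * (δ * δ)) ≤
        ∑ i, volume (S i \ ballStar (S i)) := by
    intro n
    induction n with
    | zero => exact ⟨S, hS, hSR, le_rfl, fun _ => rfl, by simp⟩
    | succ n ih =>
      obtain ⟨T, hT, hTR, hle, hvol, hsum⟩ := ih
      obtain ⟨i, hi⟩ := hcon T hT hTR hle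
      obtain ⟨e, he, h1⟩ := hgain (T i) (symmRadius (S i)) (hT i) (hTR i)
        (symmRadius_le_of_subset_ball hR.le (hSR i))
      rw [← ballStar] at h1
      have hsymm : volume (ballStar (S i) \ T i) = volume (T i \ ballStar (S i)) :=
        measure_sdiff_symm (measurableSet_ballStar _).nullMeasurableSet
          (hT i).nullMeasurableSet (by rw [hvol, volume_ballStar (hfinR (hSR i))])
          (measure_ne_top_of_subset Set.inter_subset_right (hfinR (hTR i)))
      refine ⟨fun j => steiner e (T j), fun j => measurableSet_steiner (hT j), fun j => ?_,
        hle.trans (rieszFunctional_le_steiner he (hT 0) (hT 1) (hT 2) (hTR 0) (hTR 1) (hTR 2)),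
        fun j => by rw [volume_steiner he (hT j) (hTR j), hvol], le_trans ?_ hsum⟩
      · rw [← steiner_ball he R]
        exact steiner_mono (hTR j)
      · have h2 : ∀ j, volume (steiner e (T j) \ ballStar (S j)) +
            (if j = i then K * (δ * δ) else 0) ≤ volume (T j \ ballStar (S j)) := by
          intro j
          split_ifs with hj
          · subst hj
            refine le_trans ?_ h1
            rw [hsymm]
            gcongr
          · rw [add_zero]
            exact le_trans le_self_add (volume_steiner_sdiff_ball he (hT j) (hTR j))
        have h3 := Finset.sum_le_sum fun j (_ : j ∈ Finset.univ) => h2 j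
        rw [Finset.sum_add_distrib, Finset.sum_ite_eq' Finset.univ i,
          if_pos (Finset.mem_univ _)] at h3
        calc _ = (∑ j, volume (steiner e (T j) \ ballStar (S j)) + K * (δ * δ)) +
              n * (K * (δ * δ)) := by push_cast; ring
          _ ≤ _ := by gcongr
  have hfin : ∑ i, volume (S i \ ballStar (S i)) ≠ ∞ :=
    ENNReal.sum_ne_top.2 fun i _ => hfinR (Set.sdiff_subset.trans (hSR i))
  obtain ⟨n, hn⟩ := ENNReal.exists_nat_mul_gt (mul_ne_zero hK (mul_ne_zero hδ hδ)) hfin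
  obtain ⟨T, -, -, -, -, h⟩ := iterate n
  exact absurd (le_trans le_add_self h) (not_le.2 hn)

theorem rieszFunctional_le_add_sdiff {V : Type*} [AddCommGroup V] [MeasureSpace V]
    [MeasurableAdd₂ V] [MeasurableNeg V] [SFinite (volume : Measure V)]
    [(volume : Measure V).IsAddLeftInvariant]
    {A B C A' B' C' : Set V} (hA : MeasurableSet A) (hB : MeasurableSet B)
    (hC : MeasurableSet C) (hC' : MeasurableSet C') :
    rieszFunctional A B C ≤ rieszFunctional A' B' C' + volume (A \ A') * volume B +
      volume A * volume (B \ B') + volume A * volume (C \ C') := by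
  calc rieszFunctional A B C ≤ rieszFunctional A' B' C' + rieszFunctional (A \ A') B C +
        rieszFunctional A (B \ B') C + rieszFunctional A B (C \ C') := by
        simp only [rieszFunctional]
        refine le_trans (measure_mono ?_) ((measure_union_le _ _).trans (add_le_add
          ((measure_union_le _ _).trans (add_le_add (measure_union_le _ _) le_rfl)) le_rfl))
        rintro p ⟨h1, h2, h3⟩
        by_cases h4 : p.1 ∈ A'
        · by_cases h5 : p.2 ∈ B'
          · by_cases h6 : p.1 + p.2 ∈ C'
            · exact .inl (.inl (.inl ⟨h4, h5, h6⟩))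
            · exact .inr ⟨h1, h2, h3, h6⟩
          · exact .inl (.inr ⟨h1, ⟨h2, h5⟩, h3⟩)
        · exact .inl (.inl (.inr ⟨⟨h1, h4⟩, h2, h3⟩))
    _ ≤ _ := by
        gcongr
        · exact rieszFunctional_le_mul
        · exact rieszFunctional_le_mul
        · exact rieszFunctional_le_mul' hA hB (hC.diff hC')

theorem rieszFunctional_le_ballStar_of_subset_ball {A B C : Set (EuclideanSpace ℝ (Fin d))}
    (hA : MeasurableSet A) (hB : MeasurableSet B) (hC : MeasurableSet C) {R : ℝ} (hR : 0 < R)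
    (hAR : A ⊆ Metric.ball 0 R) (hBR : B ⊆ Metric.ball 0 R) (hCR : C ⊆ Metric.ball 0 R) :
    rieszFunctional A B C ≤ rieszFunctional (ballStar A) (ballStar B) (ballStar C) := by
  set M := volume (Metric.ball (0 : EuclideanSpace ℝ (Fin d)) R)
  have hM0 : 3 * M ≠ 0 :=
    mul_ne_zero (by norm_num) (Metric.measure_ball_pos volume _ hR).ne'
  have hM1 : 3 * M ≠ ∞ := ENNReal.mul_ne_top (by norm_num) measure_ball_lt_top.ne
  refine ENNReal.le_of_forall_pos_le_add fun ε hε _ => ?_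
  obtain ⟨T, hT, hTR, hle, hnear⟩ := exists_rieszFunctional_le_near_ballStar
    (S := ![A, B, C]) (by simp [Fin.forall_fin_succ, *]) hR (by simp [Fin.forall_fin_succ, *])
    (δ := ε / (3 * M)) (ENNReal.div_ne_zero.2 ⟨by simpa using hε.ne', hM1⟩)
  refine hle.trans ((rieszFunctional_le_add_sdiff (A' := ballStar A) (B' := ballStar B)
    (hT 0) (hT 1) (hT 2) (measurableSet_ballStar C)).trans ?_)
  have h0 := hnear 0
  have h1 := hnear 1
  have h2 := hnear 2
  simp only [Matrix.cons_val] at h0 h1 h2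
  calc _ ≤ rieszFunctional (ballStar A) (ballStar B) (ballStar C) + (ε / (3 * M)) * M +
        M * (ε / (3 * M)) + M * (ε / (3 * M)) := by
        gcongr <;> exact measure_mono (hTR _)
    _ = rieszFunctional (ballStar A) (ballStar B) (ballStar C) + (ε / (3 * M)) * (3 * M) := by
        ring
    _ = _ := by rw [ENNReal.div_mul_cancel hM0 hM1]

/-- The Riesz rearrangement inequality for sets. -/
theorem rieszFunctional_le_ballStar {A B C : Set (EuclideanSpace ℝ (Fin d))}
    (hA : MeasurableSet A) (hB : MeasurableSet B) (hC : MeasurableSet C)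
    (hAf : volume A ≠ ∞) (hBf : volume B ≠ ∞) (hCf : volume C ≠ ∞) :
    rieszFunctional A B C ≤ rieszFunctional (ballStar A) (ballStar B) (ballStar C) := by
  set b : ℕ → Set (EuclideanSpace ℝ (Fin d)) := fun n => Metric.ball 0 (n + 1)
  have hb : Monotone b := fun m n h => Metric.ball_subset_ball (by simpa using h)
  set Z : ℕ → Set (EuclideanSpace ℝ (Fin d) × EuclideanSpace ℝ (Fin d)) := fun n =>
    {p | p.1 ∈ A ∩ b n ∧ p.2 ∈ B ∩ b n ∧ p.1 + p.2 ∈ C ∩ b n}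
  have hZ : Monotone Z := fun m n h p hp =>
    ⟨⟨hp.1.1, hb h hp.1.2⟩, ⟨hp.2.1.1, hb h hp.2.1.2⟩, ⟨hp.2.2.1, hb h hp.2.2.2⟩⟩
  have hU : {p : EuclideanSpace ℝ (Fin d) × EuclideanSpace ℝ (Fin d) |
      p.1 ∈ A ∧ p.2 ∈ B ∧ p.1 + p.2 ∈ C} = ⋃ n, Z n := by
    ext p
    simp only [Set.mem_iUnion, Z, Set.mem_ofPred_eq, Set.mem_inter_iff]
    constructor
    · rintro ⟨h1, h2, h3⟩
      obtain ⟨n, hn⟩ := exists_nat_gt (max (max ‖p.1‖ ‖p.2‖) ‖p.1 + p.2‖)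
      have hmem : ∀ x : EuclideanSpace ℝ (Fin d), ‖x‖ < n → x ∈ b n := fun x hx => by
        simp only [b, mem_ball_zero_iff]; linarith
      simp only [max_lt_iff] at hn
      exact ⟨n, ⟨h1, hmem _ hn.1.1⟩, ⟨h2, hmem _ hn.1.2⟩, ⟨h3, hmem _ hn.2⟩⟩
    · rintro ⟨n, h1, h2, h3⟩
      exact ⟨h1.1, h2.1, h3.1⟩
  have hlim := tendsto_measure_iUnion_atTop (μ := volume.prod volume) hZ
  rw [← hU] at hlim
  refine le_of_tendsto' hlim fun n => ?_
  have hbm : MeasurableSet (b n) := measurableSet_ball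
  refine (rieszFunctional_le_ballStar_of_subset_ball (hA.inter hbm) (hB.inter hbm)
    (hC.inter hbm) (by positivity) Set.inter_subset_right Set.inter_subset_right
    Set.inter_subset_right).trans (rieszFunctional_mono ?_ ?_ ?_)
  · exact ballStar_mono hAf (measure_mono Set.inter_subset_left)
  · exact ballStar_mono hBf (measure_mono Set.inter_subset_left)
  · exact ballStar_mono hCf (measure_mono Set.inter_subset_left)

end Riesz

section LayerCake

theorem lintegral_Ioi_indicator_ofReal_lt (c : ℝ≥0∞) :
    ∫⁻ t in Set.Ioi (0 : ℝ), {t : ℝ | ENNReal.ofReal t < c}.indicator 1 t = c := by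
  have hm : MeasurableSet {t : ℝ | ENNReal.ofReal t < c} :=
    measurableSet_lt ENNReal.measurable_ofReal measurable_const
  rw [lintegral_indicator_one hm, Measure.restrict_apply hm]
  rcases eq_or_ne c ∞ with rfl | hc
  · simp
  · have : {t : ℝ | ENNReal.ofReal t < c} ∩ Set.Ioi 0 = Set.Ioo 0 c.toReal := by
      ext t
      simp only [Set.mem_inter_iff, Set.mem_ofPred_eq, Set.mem_Ioi, Set.mem_Ioo]
      rw [and_comm]
      refine and_congr_right fun ht => ?_
      rw [ENNReal.ofReal_lt_iff_lt_toReal (le_of_lt ht) hc]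
    rw [this, Real.volume_Ioo, sub_zero, ENNReal.ofReal_toReal hc]

variable {α : Type*} [MeasurableSpace α] {μ : Measure α} [SFinite μ]

theorem setLIntegral_layer_mul {P : Set (α × ℝ)} (hP : MeasurableSet P) {S : Set α}
    {u : α → ℝ≥0∞} (hu : Measurable u) :
    ∫⁻ x in S, (∫⁻ t in Set.Ioi (0 : ℝ), P.indicator 1 (x, t)) * u x ∂μ =
      ∫⁻ t in Set.Ioi (0 : ℝ), ∫⁻ x in {x | (x, t) ∈ P} ∩ S, u x ∂μ := by
  have h1 : Measurable (P.indicator (1 : α × ℝ → ℝ≥0∞)) := measurable_one.indicator hP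
  calc _ = ∫⁻ x in S, ∫⁻ t in Set.Ioi (0 : ℝ), P.indicator 1 (x, t) * u x ∂volume ∂μ := by
        refine lintegral_congr fun x => ?_
        exact (lintegral_mul_const _ (h1.comp measurable_prodMk_left)).symm
    _ = ∫⁻ t in Set.Ioi (0 : ℝ), ∫⁻ x in S, P.indicator 1 (x, t) * u x ∂μ :=
        lintegral_lintegral_swap (h1.mul (hu.comp measurable_fst)).aemeasurable
    _ = _ := by
        refine lintegral_congr fun t => ?_
        have hm : MeasurableSet {x | (x, t) ∈ P} := measurable_prodMk_right hP
        rw [← Measure.restrict_restrict hm, ← lintegral_indicator hm]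
        refine lintegral_congr fun x => ?_
        by_cases hx : (x, t) ∈ P
        · rw [Set.indicator_of_mem hx, Set.indicator_of_mem (by exact hx), Pi.one_apply, one_mul]
        · rw [Set.indicator_of_notMem hx, Set.indicator_of_notMem (by exact hx), zero_mul]

theorem setLIntegral_mul_eq_layer {g : α → ℝ≥0∞} (hg : Measurable g) {S : Set α}
    {u : α → ℝ≥0∞} (hu : Measurable u) :
    ∫⁻ x in S, g x * u x ∂μ =
      ∫⁻ t in Set.Ioi (0 : ℝ), ∫⁻ x in {x | ENNReal.ofReal t < g x} ∩ S, u x ∂μ := by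
  have hP : MeasurableSet {p : α × ℝ | ENNReal.ofReal p.2 < g p.1} :=
    measurableSet_lt (ENNReal.measurable_ofReal.comp measurable_snd) (hg.comp measurable_fst)
  refine Eq.trans (lintegral_congr fun x => ?_) (setLIntegral_layer_mul hP hu)
  congr 1
  exact (lintegral_Ioi_indicator_ofReal_lt (g x)).symm

theorem setLIntegral_ofReal_mul_eq_layer {f : α → ℝ} (hf : Measurable f) {S : Set α}
    {u : α → ℝ≥0∞} (hu : Measurable u) :
    ∫⁻ x in S, ENNReal.ofReal (f x) * u x ∂μ =
      ∫⁻ t in Set.Ioi (0 : ℝ), ∫⁻ x in {x | t < f x} ∩ S, u x ∂μ := by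
  rw [setLIntegral_mul_eq_layer (g := fun x => ENNReal.ofReal (f x))
    (ENNReal.measurable_ofReal.comp hf) hu]
  refine setLIntegral_congr_fun measurableSet_Ioi fun t ht => ?_
  have : {x | ENNReal.ofReal t < ENNReal.ofReal (f x)} = {x | t < f x} := Set.ext fun x =>
    ENNReal.ofReal_lt_ofReal_iff'.trans ⟨And.left, fun h => ⟨h, (show 0 < t from ht).trans h⟩⟩
  simp only [this]

omit [SFinite μ] in
/-- Bathtub principle: some set of measure at most `V` meets all superlevel sets maximally. -/
theorem exists_measure_le_forall_min_le {f : α → ℝ} (hf : Measurable f)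
    {N : α → ℝ} (hN : Measurable N) (hNnull : ∀ r, μ {x | N x = r} = 0)
    (hfin : ∀ t, 0 < t → μ {x | t < f x} ≠ ∞) {V : ℝ≥0∞}
    (hex : ∃ t, 0 < t ∧ μ {x | t < f x} ≤ V) :
    ∃ G, MeasurableSet G ∧ μ G ≤ V ∧
      ∀ t, 0 < t → min V (μ {x | t < f x}) ≤ μ ({x | t < f x} ∩ G) := by
  set T := {t : ℝ | 0 < t ∧ μ {x | t < f x} ≤ V}
  have hbdd : BddBelow T := ⟨0, fun t ht => ht.1.le⟩
  set s := sInf T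
  have hs0 : 0 ≤ s := le_csInf hex fun t ht => ht.1.le
  have hmeas : ∀ t, MeasurableSet {x | t < f x} := fun t => measurableSet_lt measurable_const hf
  have hanti : ∀ {t t' : ℝ}, t ≤ t' → {x | t' < f x} ⊆ {x | t < f x} := fun h x hx =>
    lt_of_le_of_lt h hx
  have hgt : ∀ t, s < t → μ {x | t < f x} ≤ V := fun t ht => by
    obtain ⟨t', ht', h⟩ := exists_lt_of_csInf_lt hex ht
    exact (measure_mono (hanti h.le)).trans ht'.2
  obtain ⟨v, hv, hvs, hvlim⟩ := exists_seq_strictAnti_tendsto s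
  have hG1 : μ {x | s < f x} ≤ V := by
    have hU : {x | s < f x} = ⋃ n, {x | v n < f x} := by
      ext x
      simp only [Set.mem_ofPred_eq, Set.mem_iUnion]
      refine ⟨fun h => (hvlim.eventually (gt_mem_nhds h)).exists, ?_⟩
      rintro ⟨n, hn⟩
      exact (hvs n).trans hn
    rw [hU]
    exact le_of_tendsto' (tendsto_measure_iUnion_atTop fun m n h => hanti (hv.antitone h))
      fun n => hgt _ (hvs n)
  rcases hs0.eq_or_lt with h0 | h0
  · refine ⟨{x | s < f x}, hmeas s, hG1, fun t ht => (min_le_right _ _).trans ?_⟩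
    rw [Set.inter_eq_left.2 (hanti (h0 ▸ ht.le))]
  have hfin2 : μ {x | s ≤ f x} ≠ ∞ := ne_top_of_le_ne_top (hfin (s / 2) (by positivity))
    (measure_mono fun x (hx : s ≤ f x) => (show s / 2 < f x by linarith))
  have hG2 : V ≤ μ {x | s ≤ f x} := by
    obtain ⟨w, hw, hws, hwlim⟩ := exists_seq_strictMono_tendsto' h0
    have hI : {x | s ≤ f x} = ⋂ n, {x | w n < f x} := by
      ext x
      simp only [Set.mem_ofPred_eq, Set.mem_iInter]
      exact ⟨fun h n => (hws n).2.trans_le h, fun h => le_of_tendsto' hwlim fun n => (h n).le⟩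
    rw [hI]
    refine ge_of_tendsto' (tendsto_measure_iInter_atTop
      (fun n => (hmeas _).nullMeasurableSet) (fun m n h => hanti (hw.monotone h))
      ⟨0, hfin _ (hws 0).1⟩) fun n => ?_
    by_contra! h
    exact absurd (csInf_le hbdd ⟨(hws n).1, h.le⟩) (not_le.2 (hws n).2)
  obtain ⟨G, hGm, h1, h2, h3⟩ : ∃ G, MeasurableSet G ∧ {x | s < f x} ⊆ G ∧
      G ⊆ {x | s ≤ f x} ∧ μ G = V := by
    have hm2 : MeasurableSet {x | s ≤ f x} := measurableSet_le measurable_const hf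
    have hsub : {x | s < f x} ⊆ {x | s ≤ f x} := fun x (hx : s < f x) => hx.le
    rcases hG1.eq_or_lt with h | h
    · exact ⟨_, hmeas s, subset_rfl, hsub, h⟩
    rcases hG2.eq_or_lt with h' | h'
    · exact ⟨_, hm2, hsub, subset_rfl, h'.symm⟩
    set D := {x | s ≤ f x} \ {x | s < f x}
    have hD : MeasurableSet D := hm2.diff (hmeas s)
    have : IsFiniteMeasure (μ.restrict D) :=
      ⟨by rw [Measure.restrict_apply_univ]
          exact (ne_top_of_le_ne_top hfin2 (measure_mono Set.sdiff_subset)).lt_top⟩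
    have hnull : NullSingletonClass ((μ.restrict D).map N) := ⟨fun r => by
      rw [Measure.map_apply hN (measurableSet_singleton r)]
      exact le_antisymm ((Measure.restrict_apply_le _ _).trans (hNnull r).le) bot_le⟩
    obtain ⟨y, hy⟩ := exists_measure_Iio_eq ((μ.restrict D).map N)
      (s := V - μ {x | s < f x}) (tsub_pos_of_lt h) (by
        rw [Measure.map_apply hN MeasurableSet.univ, Set.preimage_univ,
          Measure.restrict_apply_univ, measure_sdiff hsub (hmeas s).nullMeasurableSet h.ne_top]
        exact (ENNReal.cancel_of_ne h.ne_top).tsub_lt_tsub_right_of_le h.le h')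
    rw [Measure.map_apply hN measurableSet_Iio,
      Measure.restrict_apply (hN measurableSet_Iio)] at hy
    refine ⟨{x | s < f x} ∪ N ⁻¹' Set.Iio y ∩ D, (hmeas s).union
      ((hN measurableSet_Iio).inter hD), Set.subset_union_left,
      Set.union_subset hsub (Set.inter_subset_right.trans Set.sdiff_subset), ?_⟩
    rw [measure_union (Set.disjoint_sdiff_right.mono_right Set.inter_subset_right)
      ((hN measurableSet_Iio).inter hD), hy, add_tsub_cancel_of_le h.le]
  refine ⟨G, hGm, h3.le, fun t ht => ?_⟩
  rcases le_or_gt s t with h | h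
  · rw [Set.inter_eq_left.2 ((hanti h).trans h1)]
    exact min_le_right _ _
  · have h4 : G ⊆ {x | t < f x} := fun x hx => lt_of_lt_of_le h (h2 hx)
    rw [Set.inter_eq_right.2 h4, h3]
    exact min_le_left _ _

end LayerCake

section RadiallyDecreasing

/-- `w` is a nonincreasing function of the norm. -/
def RadiallyDecreasing {V : Type*} [Norm V] (w : V → ℝ≥0∞) : Prop :=
  ∀ x y, ‖x‖ ≤ ‖y‖ → w y ≤ w x

theorem RadiallyDecreasing.mul {V : Type*} [Norm V] {w w' : V → ℝ≥0∞}
    (h : RadiallyDecreasing w) (h' : RadiallyDecreasing w') :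
    RadiallyDecreasing fun x => w x * w' x :=
  fun x y hxy => mul_le_mul' (h x y hxy) (h' x y hxy)

theorem RadiallyDecreasing.prod {V ι : Type*} [Norm V] {w : ι → V → ℝ≥0∞} {s : Finset ι}
    (h : ∀ i ∈ s, RadiallyDecreasing (w i)) : RadiallyDecreasing fun x => ∏ i ∈ s, w i x :=
  fun x y hxy => Finset.prod_le_prod' fun i hi => h i hi x y hxy

theorem RadiallyDecreasing.measurable {V : Type*} [NormedAddCommGroup V] [NormedSpace ℝ V]
    [Nontrivial V] [MeasurableSpace V] [BorelSpace V] {w : V → ℝ≥0∞}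
    (h : RadiallyDecreasing w) : Measurable w := by
  obtain ⟨e, he⟩ := exists_norm_eq V zero_le_one
  have h1 : Antitone fun r : ℝ => w (max r 0 • e) := fun r s hrs => h _ _ <| by
    rw [norm_smul, norm_smul, he, mul_one, mul_one, Real.norm_of_nonneg (le_max_right _ _),
      Real.norm_of_nonneg (le_max_right _ _)]
    exact max_le_max_right 0 hrs
  have h2 : w = (fun r : ℝ => w (max r 0 • e)) ∘ norm := by
    funext x
    have : ‖max ‖x‖ 0 • e‖ = ‖x‖ := by simp [norm_smul, he]
    exact le_antisymm (h _ _ this.le) (h _ _ this.ge)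
  rw [h2]
  exact h1.measurable.comp measurable_norm

variable {V : Type*} [NormedAddCommGroup V] [InnerProductSpace ℝ V]

theorem exists_reflection_exchange [FiniteDimensional ℝ V] [MeasurableSpace V] [BorelSpace V]
    {x y : V} (hxy : ‖x‖ ≤ ‖y‖) :
    ∃ σ : V → V, MeasurePreserving σ ∧ (∀ z, ‖σ z - x‖ = ‖z - y‖) ∧
      (∀ z, ‖σ z - y‖ = ‖z - x‖) ∧ (∀ z, ‖z - x‖ ≤ ‖z - y‖ → ‖z‖ ≤ ‖σ z‖) ∧
      ∀ z, ‖z - y‖ ≤ ‖z - x‖ → ‖σ z‖ ≤ ‖z‖ := by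
  rcases eq_or_ne x y with rfl | hne
  · exact ⟨id, MeasurePreserving.id _, fun _ => rfl, fun _ => rfl, fun _ _ => le_rfl,
      fun _ _ => le_rfl⟩
  set u := x - y
  have hu : 0 < ‖u‖ := norm_pos_iff.2 (sub_ne_zero.2 hne)
  set ρ := (ℝ ∙ u)ᗮ.reflection
  have hρ : ∀ v, ρ v = v - (2 * (⟪u, v⟫ / ‖u‖ ^ 2)) • u := fun v => by
    simp only [ρ, Submodule.reflection_orthogonal_apply, Submodule.reflection_singleton_apply]
    simp [mul_smul, two_smul]
  have hρu : ρ u = -u := by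
    rw [hρ, real_inner_self_eq_norm_sq, div_self (by positivity)]
    rw [mul_one, two_smul]; abel
  have key : ∀ z, ‖u‖ ^ 2 * (‖ρ (z - y) + x‖ ^ 2 - ‖z‖ ^ 2) =
      (‖z - x‖ ^ 2 - ‖z - y‖ ^ 2) * (‖x‖ ^ 2 - ‖y‖ ^ 2) := by
    intro z
    obtain ⟨c, hc⟩ : ∃ c, c * ‖u‖ ^ 2 = ‖z - x‖ ^ 2 - ‖z - y‖ ^ 2 :=
      ⟨_, div_mul_cancel₀ _ (by positivity)⟩
    have h1 : ‖z - x‖ ^ 2 - ‖z - y‖ ^ 2 = ‖u‖ ^ 2 - 2 * ⟪u, z - y⟫ := by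
      rw [show z - x = (z - y) - u by simp [u], norm_sub_sq_real (z - y) u, real_inner_comm]
      ring
    have h2 : ρ (z - y) + x = z + c • u := by
      have h3 : 2 * (⟪u, z - y⟫ / ‖u‖ ^ 2) = 1 - c := by
        field_simp
        linarith
      rw [hρ, h3, sub_smul, one_smul]
      simp only [u]
      abel
    have h4 : ‖x‖ ^ 2 - ‖y‖ ^ 2 = ‖u‖ ^ 2 + 2 * ⟪u, y⟫ := by
      rw [show x = y + u by simp [u], norm_add_sq_real y u, real_inner_comm]
      ring
    rw [h2, norm_add_sq_real, norm_smul, real_inner_smul_right, mul_pow, Real.norm_eq_abs, sq_abs,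
      h4, ← hc, real_inner_comm]
    rw [inner_sub_right] at h1
    linear_combination (c * ‖u‖ ^ 2) * (hc.trans h1)
  refine ⟨fun z => ρ (z - y) + x, ?_, fun z => ?_, fun z => ?_, fun z hz => ?_, fun z hz => ?_⟩
  · exact (measurePreserving_add_right volume x).comp
      (ρ.measurePreserving.comp (measurePreserving_sub_right volume y))
  · rw [add_sub_cancel_right, LinearIsometryEquiv.norm_map]
  · rw [add_sub_assoc, ← neg_neg (x - y), ← hρu, ← map_neg, ← map_add,
      LinearIsometryEquiv.norm_map]
    simp [u]
  · have h1 : ‖z - x‖ ^ 2 ≤ ‖z - y‖ ^ 2 := by gcongr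
    have h2 : ‖x‖ ^ 2 ≤ ‖y‖ ^ 2 := by gcongr
    rw [← sq_le_sq₀ (norm_nonneg _) (norm_nonneg _), ← sub_nonneg]
    refine nonneg_of_mul_nonneg_right (a := ‖u‖ ^ 2) ?_ (by positivity)
    rw [key]
    nlinarith
  · have h1 : ‖z - y‖ ^ 2 ≤ ‖z - x‖ ^ 2 := by gcongr
    have h2 : ‖x‖ ^ 2 ≤ ‖y‖ ^ 2 := by gcongr
    rw [← sq_le_sq₀ (norm_nonneg _) (norm_nonneg _), ← sub_nonpos]
    by_contra! h3
    have h4 := mul_pos (pow_pos hu 2) h3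
    rw [key] at h4
    nlinarith

theorem mul_add_mul_le_mul_add_mul_of_le {a b p q : ℝ≥0∞} (h1 : b ≤ a) (h2 : q ≤ p) :
    b * p + a * q ≤ a * p + b * q := by
  obtain ⟨δ, rfl⟩ := exists_add_of_le h1
  obtain ⟨ε, rfl⟩ := exists_add_of_le h2
  calc b * (q + ε) + (b + δ) * q ≤ b * (q + ε) + (b + δ) * q + δ * ε := le_self_add
    _ = _ := by ring

variable [FiniteDimensional ℝ V] [MeasurableSpace V] [BorelSpace V] [Nontrivial V]

/-- Convolutions of radially decreasing functions are radially decreasing. -/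
theorem RadiallyDecreasing.conv {k w : V → ℝ≥0∞} (hk : RadiallyDecreasing k)
    (hw : RadiallyDecreasing w) : RadiallyDecreasing fun s => ∫⁻ z, k z * w (s + z) := by
  intro x y hxy
  have hkm := hk.measurable
  have hwm := hw.measurable
  have hk' : ∀ {a b : V}, ‖a‖ = ‖b‖ → k a = k b := fun h =>
    le_antisymm (hk _ _ h.ge) (hk _ _ h.le)
  have htr : ∀ s, ∫⁻ z, k z * w (s + z) = ∫⁻ z, k (z - s) * w z := fun s => by
    rw [← lintegral_sub_right_eq_self (fun z => k z * w (s + z)) s]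
    simp
  obtain ⟨σ, hσ, h1, h2, h3, h4⟩ := exists_reflection_exchange hxy
  have hkx : ∀ s, Measurable fun z => k (z - s) * w z := fun s =>
    (hkm.comp (measurable_sub_const s)).mul hwm
  have hx : ∫⁻ z, k (z - x) * w z = ∫⁻ z, k (z - y) * w (σ z) := by
    rw [← hσ.lintegral_comp (hkx x)]
    exact lintegral_congr fun z => by rw [hk' (h1 z)]
  have hy : ∫⁻ z, k (z - y) * w z = ∫⁻ z, k (z - x) * w (σ z) := by
    rw [← hσ.lintegral_comp (hkx y)]
    exact lintegral_congr fun z => by rw [hk' (h2 z)]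
  have hsum : (∫⁻ z, k (z - y) * w z) + ∫⁻ z, k (z - x) * w (σ z) ≤
      (∫⁻ z, k (z - x) * w z) + ∫⁻ z, k (z - y) * w (σ z) := by
    rw [← lintegral_add_left (hkx y), ← lintegral_add_left (hkx x)]
    refine lintegral_mono fun z => ?_
    rcases le_total ‖z - x‖ ‖z - y‖ with h | h
    · exact mul_add_mul_le_mul_add_mul_of_le (hk _ _ h) (hw _ _ (h3 z h))
    · have := mul_add_mul_le_mul_add_mul_of_le (hk _ _ h) (hw _ _ (h4 z h))
      rwa [add_comm (k (z - y) * w z), add_comm (k (z - x) * w z),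
        add_comm (k (z - x) * w (σ z)), add_comm (k (z - y) * w (σ z))] at *
  rw [← hx, ← hy, ← two_mul, ← two_mul, ENNReal.mul_le_mul_iff_right two_ne_zero ofNat_ne_top] at hsum
  simpa only [htr] using hsum

end RadiallyDecreasing

section SymmRearrange

variable {d : ℕ}

theorem radiallyDecreasing_symmRearrange (f : EuclideanSpace ℝ (Fin d) → ℝ) :
    RadiallyDecreasing (symmRearrange f) := fun x y hxy => by
  refine lintegral_mono fun t => ?_
  by_cases hy : y ∈ ballStar {z | t < f z}
  · have hx : x ∈ ballStar {z | t < f z} := by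
      rw [ballStar, mem_ball_zero_iff] at hy ⊢
      exact hxy.trans_lt hy
    rw [Set.indicator_of_mem hx, Set.indicator_of_mem hy]
  · rw [Set.indicator_of_notMem hy]
    exact bot_le

theorem measurable_symmRadius_superlevel (f : EuclideanSpace ℝ (Fin d) → ℝ) :
    Measurable fun t : ℝ => symmRadius {y | t < f y} := by
  have h : Antitone fun t : ℝ => volume {y | t < f y} := fun s t hst =>
    measure_mono fun y hy => lt_of_le_of_lt hst hy
  exact ((h.measurable.div_const _).ennreal_toReal).pow_const _

theorem setLIntegral_symmRearrange_mul_eq_layer (f : EuclideanSpace ℝ (Fin d) → ℝ)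
    {S : Set (EuclideanSpace ℝ (Fin d))} {w : EuclideanSpace ℝ (Fin d) → ℝ≥0∞}
    (hw : Measurable w) :
    ∫⁻ x in S, symmRearrange f x * w x =
      ∫⁻ t in Set.Ioi (0 : ℝ), ∫⁻ x in ballStar {y | t < f y} ∩ S, w x := by
  have hP : MeasurableSet {p : EuclideanSpace ℝ (Fin d) × ℝ | p.1 ∈ ballStar {y | p.2 < f y}} := by
    simp only [ballStar, mem_ball_zero_iff]
    exact measurableSet_lt measurable_fst.norm
      ((measurable_symmRadius_superlevel f).comp measurable_snd)
  exact setLIntegral_layer_mul hP hw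

end SymmRearrange

section Majorized

variable {d : ℕ}

/-- The integral of `u` over each set is bounded by the integral of `w` over the ball of the same
measure. -/
def Majorized (u w : EuclideanSpace ℝ (Fin d) → ℝ≥0∞) : Prop :=
  ∀ S : Set (EuclideanSpace ℝ (Fin d)), MeasurableSet S → volume S ≠ ∞ →
    ∫⁻ x in S, u x ≤ ∫⁻ x in ballStar S, w x

variable [NeZero d] {u w : EuclideanSpace ℝ (Fin d) → ℝ≥0∞}

theorem majorized_one : Majorized (d := d) 1 1 := fun S _ hSf => by
  simp [volume_ballStar hSf]

omit [NeZero d] in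
theorem Majorized.lintegral_mul_le (h : Majorized u w) (hu : Measurable u) (hw : Measurable w)
    {f : EuclideanSpace ℝ (Fin d) → ℝ} (hf : Measurable f) (hf0 : VanishesAtInfinity f) :
    ∫⁻ x, ENNReal.ofReal (f x) * u x ≤ ∫⁻ x, symmRearrange f x * w x := by
  rw [← setLIntegral_univ, ← setLIntegral_univ fun x => symmRearrange f x * w x,
    setLIntegral_ofReal_mul_eq_layer hf hu, setLIntegral_symmRearrange_mul_eq_layer f hw]
  refine setLIntegral_mono' measurableSet_Ioi fun t ht => ?_
  rw [Set.inter_univ, Set.inter_univ]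
  exact h _ (measurableSet_lt measurable_const hf) (hf0 t ht).ne

theorem Majorized.mul (h : Majorized u w) (hu : Measurable u) (hw : Measurable w)
    {f : EuclideanSpace ℝ (Fin d) → ℝ} (hf : Measurable f) (hf0 : VanishesAtInfinity f) :
    Majorized (fun x => ENNReal.ofReal (f x) * u x) fun x => symmRearrange f x * w x := by
  intro S hS hSf
  rw [setLIntegral_ofReal_mul_eq_layer hf hu, setLIntegral_symmRearrange_mul_eq_layer f hw]
  refine setLIntegral_mono' measurableSet_Ioi fun t ht => ?_
  have h1 : volume ({x | t < f x} ∩ S) ≠ ∞ :=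
    ne_top_of_le_ne_top hSf (measure_mono Set.inter_subset_right)
  refine (h _ ((measurableSet_lt measurable_const hf).inter hS) h1).trans
    (lintegral_mono_set (Set.subset_inter ?_ ?_))
  · exact ballStar_mono (hf0 t ht).ne (measure_mono Set.inter_subset_left)
  · exact ballStar_mono hSf (measure_mono Set.inter_subset_right)

/-- The measure of the set of decompositions `y = s + (y - s)` with `s ∈ S` and `y - s ∈ F`. -/
noncomputable def overlap (S F : Set (EuclideanSpace ℝ (Fin d)))
    (y : EuclideanSpace ℝ (Fin d)) : ℝ≥0∞ :=
  volume {s | s ∈ S ∧ y - s ∈ F}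

omit [NeZero d] in
theorem measurable_overlap {S F : Set (EuclideanSpace ℝ (Fin d))} (hS : MeasurableSet S)
    (hF : MeasurableSet F) : Measurable (overlap S F) := by
  have : MeasurableSet {p : EuclideanSpace ℝ (Fin d) × EuclideanSpace ℝ (Fin d) |
      p.2 ∈ S ∧ p.1 - p.2 ∈ F} :=
    (measurable_snd hS).inter ((measurable_fst.sub measurable_snd) hF)
  exact measurable_measure_prodMk_left this

omit [NeZero d] in
theorem setLIntegral_setLIntegral_add {S F : Set (EuclideanSpace ℝ (Fin d))}
    (hS : MeasurableSet S) (hF : MeasurableSet F) (hu : Measurable u) :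
    ∫⁻ z in F, ∫⁻ s in S, u (s + z) = ∫⁻ y, overlap S F y * u y := by
  have hS1 : Measurable (S.indicator (1 : EuclideanSpace ℝ (Fin d) → ℝ≥0∞)) :=
    measurable_one.indicator hS
  have hF1 : Measurable (F.indicator (1 : EuclideanSpace ℝ (Fin d) → ℝ≥0∞)) :=
    measurable_one.indicator hF
  have hu2 : Measurable fun p : EuclideanSpace ℝ (Fin d) × EuclideanSpace ℝ (Fin d) =>
      u (p.1 + p.2) := hu.comp (measurable_fst.add measurable_snd)
  rw [lintegral_lintegral_swap (f := fun z s => u (s + z))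
    (hu.comp (measurable_snd.add measurable_fst)).aemeasurable]
  calc _ = ∫⁻ s, ∫⁻ z, S.indicator 1 s * F.indicator 1 z * u (s + z) := by
        rw [← lintegral_indicator hS]
        refine lintegral_congr fun s => ?_
        by_cases hs : s ∈ S
        · rw [Set.indicator_of_mem hs, ← lintegral_indicator hF]
          refine lintegral_congr fun z => ?_
          by_cases hz : z ∈ F <;> simp [hs, hz]
        · simp [hs]
    _ = ∫⁻ y, ∫⁻ s, S.indicator 1 s * F.indicator 1 (y - s) * u (s + (y - s)) :=
        lintegral_lintegral_eq_antidiagonal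
          (((hS1.comp measurable_fst).mul (hF1.comp measurable_snd)).mul hu2)
    _ = _ := by
        refine lintegral_congr fun y => ?_
        have hm : MeasurableSet {s | s ∈ S ∧ y - s ∈ F} :=
          hS.inter ((measurable_const.sub measurable_id) hF)
        rw [overlap, ← lintegral_indicator_one hm, ← lintegral_mul_const _
          (measurable_one.indicator hm)]
        refine lintegral_congr fun s => ?_
        by_cases hs : s ∈ S <;> by_cases hz : y - s ∈ F <;> simp [hs, hz]

omit [NeZero d] in
theorem lintegral_overlap {S F : Set (EuclideanSpace ℝ (Fin d))}
    (hS : MeasurableSet S) (hF : MeasurableSet F) :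
    ∫⁻ y, overlap S F y = volume F * volume S := by
  have := setLIntegral_setLIntegral_add (u := 1) hS hF measurable_one
  simp only [Pi.one_apply, mul_one, setLIntegral_const, one_mul] at this
  rw [← this, mul_comm]

omit [NeZero d] in
theorem overlap_le {S F : Set (EuclideanSpace ℝ (Fin d))} (y : EuclideanSpace ℝ (Fin d)) :
    overlap S F y ≤ volume S :=
  measure_mono fun _ h => h.1

omit [NeZero d] in
theorem eq_univ_of_volume_eq_top {B : Set (EuclideanSpace ℝ (Fin d))}
    (hB : ∀ x y, ‖x‖ ≤ ‖y‖ → y ∈ B → x ∈ B) (h : volume B = ∞) : B = Set.univ := by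
  by_contra! hne
  obtain ⟨x, hx⟩ := (Set.ne_univ_iff_exists_notMem B).1 hne
  have h1 : B ⊆ Metric.ball 0 ‖x‖ := fun y hy => by
    rw [mem_ball_zero_iff]
    by_contra! h2
    exact hx (hB x y h2 hy)
  exact absurd (measure_mono h1) (not_le.2 (h ▸ measure_ball_lt_top))

theorem volume_norm_eq (r : ℝ) :
    volume {x : EuclideanSpace ℝ (Fin d) | ‖x‖ = r} = 0 := by
  have : {x : EuclideanSpace ℝ (Fin d) | ‖x‖ = r} = Metric.sphere 0 r := by ext; simp
  rw [this, Measure.addHaar_sphere]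

/-- The rearrangement of the overlap function of two sets is dominated in the sense of integrals
over centered balls by the overlap function of the rearranged sets. -/
theorem setLIntegral_symmRearrange_overlap_le {S F B : Set (EuclideanSpace ℝ (Fin d))}
    (hS : MeasurableSet S) (hF : MeasurableSet F) (hSf : volume S ≠ ∞) (hFf : volume F ≠ ∞)
    (hB : ∀ x y, ‖x‖ ≤ ‖y‖ → y ∈ B → x ∈ B)
    (hvan : VanishesAtInfinity fun y => (overlap S F y).toReal) :
    ∫⁻ x in B, symmRearrange (fun y => (overlap S F y).toReal) x ≤
      ∫⁻ x in B, overlap (ballStar S) (ballStar F) x := by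
  set a : EuclideanSpace ℝ (Fin d) → ℝ := fun y => (overlap S F y).toReal
  have ham : Measurable a := (measurable_overlap hS hF).ennreal_toReal
  have hoa : ∀ y, overlap S F y = ENNReal.ofReal (a y) := fun y =>
    (ENNReal.ofReal_toReal (ne_top_of_le_ne_top hSf (overlap_le y))).symm
  have hlayer : ∀ G : Set (EuclideanSpace ℝ (Fin d)), ∫⁻ x in G, overlap S F x =
      ∫⁻ t in Set.Ioi (0 : ℝ), volume ({x | t < a x} ∩ G) := fun G => by
    simpa [hoa] using setLIntegral_ofReal_mul_eq_layer (μ := volume) ham (S := G) (u := 1)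
      measurable_one
  have hlayer' : ∫⁻ x in B, symmRearrange a x =
      ∫⁻ t in Set.Ioi (0 : ℝ), volume (ballStar {x | t < a x} ∩ B) := by
    simpa using setLIntegral_symmRearrange_mul_eq_layer a (S := B) (w := 1) measurable_one
  rw [hlayer']
  rcases eq_or_ne (volume B) ∞ with hBf | hBf
  · rw [eq_univ_of_volume_eq_top hB hBf, setLIntegral_univ, lintegral_overlap
      (measurableSet_ballStar S) (measurableSet_ballStar F), volume_ballStar hSf,
      volume_ballStar hFf, ← lintegral_overlap hS hF, ← setLIntegral_univ (overlap S F), hlayer]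
    refine setLIntegral_mono' measurableSet_Ioi fun t ht => ?_
    rw [Set.inter_univ, Set.inter_univ, volume_ballStar (hvan t ht).ne]
  obtain ⟨G, hG, hGB, hmin⟩ := exists_measure_le_forall_min_le (μ := volume) ham measurable_norm
    volume_norm_eq (fun t ht => (hvan t ht).ne) (V := volume B)
    ⟨(volume S).toReal + 1, by positivity, by
      have : {x | (volume S).toReal + 1 < a x} = ∅ := by
        ext x
        have h1 := ENNReal.toReal_mono hSf (overlap_le (S := S) (F := F) x)
        simp only [Set.mem_ofPred_eq, Set.mem_empty_iff_false, iff_false, not_lt]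
        exact h1.trans (by linarith)
      simp [this]⟩
  have hGf : volume G ≠ ∞ := ne_top_of_le_ne_top hBf hGB
  calc _ ≤ ∫⁻ t in Set.Ioi (0 : ℝ), volume ({x | t < a x} ∩ G) := by
        refine setLIntegral_mono' measurableSet_Ioi fun t ht => le_trans (le_min ?_ ?_) (hmin t ht)
        · exact measure_mono Set.inter_subset_right
        · exact (measure_mono Set.inter_subset_left).trans (volume_ballStar (hvan t ht).ne).le
    _ = rieszFunctional S F G := by
        rw [← hlayer, rieszFunctional_eq_setLIntegral hS hF hG]
        rfl
    _ ≤ rieszFunctional (ballStar S) (ballStar F) (ballStar G) :=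
        rieszFunctional_le_ballStar hS hF hG hSf hFf hGf
    _ = ∫⁻ x in ballStar G, overlap (ballStar S) (ballStar F) x :=
        rieszFunctional_eq_setLIntegral (measurableSet_ballStar S) (measurableSet_ballStar F)
          (measurableSet_ballStar G)
    _ ≤ _ := lintegral_mono_set (ballStar_subset_of_volume_le hB hGf hGB)

theorem Majorized.setLIntegral_setLIntegral_le (h : Majorized u w) (hu : Measurable u)
    (hw : RadiallyDecreasing w) {S F : Set (EuclideanSpace ℝ (Fin d))}
    (hS : MeasurableSet S) (hF : MeasurableSet F) (hSf : volume S ≠ ∞) (hFf : volume F ≠ ∞) :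
    ∫⁻ z in F, ∫⁻ s in S, u (s + z) ≤
      ∫⁻ z in ballStar F, ∫⁻ s in ballStar S, w (s + z) := by
  have hwm := hw.measurable
  rw [setLIntegral_setLIntegral_add hS hF hu, setLIntegral_setLIntegral_add
    (measurableSet_ballStar S) (measurableSet_ballStar F) hwm]
  set a : EuclideanSpace ℝ (Fin d) → ℝ := fun y => (overlap S F y).toReal
  have ham : Measurable a := (measurable_overlap hS hF).ennreal_toReal
  have hfin : ∀ y, overlap S F y ≠ ∞ := fun y => ne_top_of_le_ne_top hSf (overlap_le y)
  have hoa : ∀ y, overlap S F y = ENNReal.ofReal (a y) := fun y =>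
    (ENNReal.ofReal_toReal (hfin y)).symm
  have hvan : VanishesAtInfinity a := fun t ht => by
    have h1 := mul_meas_ge_le_lintegral (μ := volume) (measurable_overlap hS hF)
      (ENNReal.ofReal t)
    rw [lintegral_overlap hS hF] at h1
    refine lt_of_le_of_lt (measure_mono fun y (hy : t < a y) => ?_)
      (ENNReal.lt_top_of_mul_ne_top_right (ne_top_of_le_ne_top (ENNReal.mul_ne_top hFf hSf) h1)
        (by simpa using ht))
    exact ENNReal.ofReal_le_of_le_toReal hy.le
  calc ∫⁻ y, overlap S F y * u y = ∫⁻ y, ENNReal.ofReal (a y) * u y := by simp_rw [hoa]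
    _ ≤ ∫⁻ y, symmRearrange a y * w y := h.lintegral_mul_le hu hwm ham hvan
    _ = ∫⁻ y, w y * symmRearrange a y := by simp_rw [mul_comm]
    _ ≤ ∫⁻ y, w y * overlap (ballStar S) (ballStar F) y := by
        rw [← setLIntegral_univ, ← setLIntegral_univ fun y => w y * overlap _ _ y,
          setLIntegral_mul_eq_layer hwm (radiallyDecreasing_symmRearrange a).measurable,
          setLIntegral_mul_eq_layer hwm
            (measurable_overlap (measurableSet_ballStar S) (measurableSet_ballStar F))]
        refine lintegral_mono fun t => ?_
        rw [Set.inter_univ]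
        exact setLIntegral_symmRearrange_overlap_le hS hF hSf hFf
          (fun x y hxy hy => lt_of_lt_of_le hy (hw x y hxy)) hvan
    _ = _ := by simp_rw [mul_comm]

theorem Majorized.conv (h : Majorized u w) (hu : Measurable u)
    (hw : RadiallyDecreasing w) {φ : EuclideanSpace ℝ (Fin d) → ℝ} (hφ : Measurable φ)
    (hφ0 : VanishesAtInfinity φ) :
    Majorized (fun s => ∫⁻ z, ENNReal.ofReal (φ z) * u (s + z))
      fun s => ∫⁻ z, symmRearrange φ z * w (s + z) := by
  intro S hS hSf
  have hwm := hw.measurable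
  have hswap : ∀ {v g : EuclideanSpace ℝ (Fin d) → ℝ≥0∞} {T : Set (EuclideanSpace ℝ (Fin d))},
      Measurable v → Measurable g → ∫⁻ s in T, ∫⁻ z, g z * v (s + z) =
        ∫⁻ z in Set.univ, g z * ∫⁻ s in T, v (s + z) := by
    intro v g T hv hg
    rw [lintegral_lintegral_swap ((hg.comp measurable_snd).mul
      (hv.comp (measurable_fst.add measurable_snd))).aemeasurable, setLIntegral_univ]
    refine lintegral_congr fun z => lintegral_const_mul _ ?_
    exact hv.comp (measurable_add_const z)
  have hint : ∀ {v : EuclideanSpace ℝ (Fin d) → ℝ≥0∞} {T : Set (EuclideanSpace ℝ (Fin d))},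
      Measurable v → Measurable fun z => ∫⁻ s in T, v (s + z) := fun hv =>
    (hv.comp (measurable_snd.add measurable_fst)).lintegral_prod_right'
  rw [hswap hu hφ.ennreal_ofReal, hswap hwm (radiallyDecreasing_symmRearrange φ).measurable,
    setLIntegral_ofReal_mul_eq_layer hφ (hint hu),
    setLIntegral_symmRearrange_mul_eq_layer φ (hint hwm)]
  refine setLIntegral_mono' measurableSet_Ioi fun t ht => ?_
  rw [Set.inter_univ, Set.inter_univ]
  exact h.setLIntegral_setLIntegral_le hu hw hS (measurableSet_lt measurable_const hφ) hSf
    (hφ0 t ht).ne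

end Majorized

section Walk

variable {d : ℕ}

theorem partialSum_zero {K : ℕ} (p : Fin K → EuclideanSpace ℝ (Fin d)) : partialSum p 0 = 0 := by
  simp [partialSum]

theorem partialSum_cons_succ {K : ℕ} (z : EuclideanSpace ℝ (Fin d))
    (q : Fin K → EuclideanSpace ℝ (Fin d)) (n : ℕ) :
    partialSum (Fin.cons z q : Fin (K + 1) → EuclideanSpace ℝ (Fin d)) (n + 1) =
      z + partialSum q n := by
  simp [partialSum, Fin.sum_univ_succ]

theorem measurable_partialSum {K : ℕ} (n : ℕ) :
    Measurable fun p : Fin K → EuclideanSpace ℝ (Fin d) => partialSum p n := by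
  refine Finset.measurable_fun_sum _ fun j _ => ?_
  split_ifs
  · exact measurable_pi_apply j
  · exact measurable_const

/-- The total weight of the walks started at `s` with `K` steps of weight `ψ`, where the position
after `n` steps has weight `h n`. -/
noncomputable def walkWeight (K : ℕ) (h : ℕ → EuclideanSpace ℝ (Fin d) → ℝ≥0∞)
    (ψ : EuclideanSpace ℝ (Fin d) → ℝ≥0∞) (s : EuclideanSpace ℝ (Fin d)) : ℝ≥0∞ :=
  ∫⁻ p : Fin K → EuclideanSpace ℝ (Fin d),
    (∏ n ∈ Finset.range (K + 1), h n (s + partialSum p n)) * ∏ j, ψ (p j)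

variable {h : ℕ → EuclideanSpace ℝ (Fin d) → ℝ≥0∞} {ψ : EuclideanSpace ℝ (Fin d) → ℝ≥0∞}

theorem measurable_walkWeight_integrand {α : Type*} [MeasurableSpace α] {K : ℕ}
    {a : α → EuclideanSpace ℝ (Fin d)} {p : α → Fin K → EuclideanSpace ℝ (Fin d)}
    (ha : Measurable a) (hp : Measurable p) (hh : ∀ n, Measurable (h n)) (hψ : Measurable ψ) :
    Measurable fun x =>
      (∏ n ∈ Finset.range (K + 1), h n (a x + partialSum (p x) n)) * ∏ j, ψ (p x j) := by
  refine Measurable.mul (Finset.measurable_fun_prod _ fun n _ => ?_)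
    (Finset.measurable_fun_prod _ fun j _ => ?_)
  · exact (hh n).comp (ha.add ((measurable_partialSum n).comp hp))
  · exact hψ.comp ((measurable_pi_apply j).comp hp)

theorem measurable_walkWeight (K : ℕ) (hh : ∀ n, Measurable (h n)) (hψ : Measurable ψ) :
    Measurable (walkWeight K h ψ) :=
  (measurable_walkWeight_integrand measurable_fst measurable_snd hh hψ).lintegral_prod_right'

theorem walkWeight_zero (h : ℕ → EuclideanSpace ℝ (Fin d) → ℝ≥0∞)
    (ψ : EuclideanSpace ℝ (Fin d) → ℝ≥0∞) : walkWeight 0 h ψ = h 0 := by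
  funext s
  simp [walkWeight, partialSum_zero, lintegral_unique, volume_pi]

theorem lintegral_fin_succ {X : Type*} [MeasureSpace X] [SigmaFinite (volume : Measure X)] {K : ℕ}
    (F : (Fin (K + 1) → X) → ℝ≥0∞) :
    ∫⁻ p, F p = ∫⁻ q : X × (Fin K → X), F (Fin.cons q.1 q.2) := by
  have h := (volume_preserving_piFinSuccAbove (fun _ : Fin (K + 1) => X) 0).symm
  rw [← h.lintegral_comp_emb (MeasurableEquiv.measurableEmbedding _)]
  refine lintegral_congr fun q => congrArg F ?_
  simp [MeasurableEquiv.piFinSuccAbove, Fin.insertNthEquiv]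

theorem lintegral_prod_fst_mul {X Y : Type*} [MeasureSpace X] [MeasureSpace Y]
    [SFinite (volume : Measure Y)] {g : X → ℝ≥0∞} {F : X × Y → ℝ≥0∞} (hg : Measurable g)
    (hF : Measurable F) :
    ∫⁻ p : X × Y, g p.1 * F p = ∫⁻ x, g x * ∫⁻ y, F (x, y) := by
  have h : Measurable fun p : X × Y => g p.1 * F p := (hg.comp measurable_fst).mul hF
  rw [Measure.volume_eq_prod, lintegral_prod _ h.aemeasurable]
  exact lintegral_congr fun x => lintegral_const_mul (f := fun y => F (x, y)) (g x)
    (hF.comp measurable_prodMk_left)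

theorem walkWeight_succ (K : ℕ) (hh : ∀ n, Measurable (h n)) (hψ : Measurable ψ) :
    walkWeight (K + 1) h ψ =
      fun s => h 0 s * ∫⁻ z, ψ z * walkWeight K (fun n => h (n + 1)) ψ (s + z) := by
  funext s
  have hm : Measurable fun q : EuclideanSpace ℝ (Fin d) × (Fin K → EuclideanSpace ℝ (Fin d)) =>
      (∏ n ∈ Finset.range (K + 1), h (n + 1) (s + q.1 + partialSum q.2 n)) * ∏ j, ψ (q.2 j) :=
    measurable_walkWeight_integrand (measurable_const.add measurable_fst) measurable_snd
      (fun n => hh (n + 1)) hψ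
  have hint : ∀ q : EuclideanSpace ℝ (Fin d) × (Fin K → EuclideanSpace ℝ (Fin d)),
      (∏ n ∈ Finset.range (K + 1 + 1), h n (s + partialSum (Fin.cons q.1 q.2 :
        Fin (K + 1) → EuclideanSpace ℝ (Fin d)) n)) *
        ∏ j, ψ ((Fin.cons q.1 q.2 : Fin (K + 1) → EuclideanSpace ℝ (Fin d)) j) =
      h 0 s * (ψ q.1 * ((∏ n ∈ Finset.range (K + 1), h (n + 1) (s + q.1 + partialSum q.2 n)) *
        ∏ j, ψ (q.2 j))) := fun q => by
    rw [Finset.prod_range_succ', partialSum_zero, add_zero, Fin.prod_univ_succ]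
    simp only [partialSum_cons_succ, Fin.cons_zero, Fin.cons_succ, ← add_assoc]
    ring
  calc _ = _ := lintegral_fin_succ _
    _ = _ := lintegral_congr hint
    _ = _ := lintegral_const_mul _ ((hψ.comp measurable_fst).mul hm)
    _ = _ := congrArg _ (lintegral_prod_fst_mul hψ hm)

theorem radiallyDecreasing_walkWeight [NeZero d] (K : ℕ) (hh : ∀ n, RadiallyDecreasing (h n))
    (hψ : RadiallyDecreasing ψ) : RadiallyDecreasing (walkWeight K h ψ) := by
  induction K generalizing h with
  | zero => exact walkWeight_zero h ψ ▸ hh 0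
  | succ K ih =>
    rw [walkWeight_succ K (fun n => (hh n).measurable) hψ.measurable]
    exact (hh 0).mul (hψ.conv (ih fun n => hh (n + 1)))

theorem Majorized.prod_mul [NeZero d] {u w : EuclideanSpace ℝ (Fin d) → ℝ≥0∞}
    (huw : Majorized u w) (hu : Measurable u) (hw : RadiallyDecreasing w) {ι : Type*}
    (f : ι → EuclideanSpace ℝ (Fin d) → ℝ) (hf : ∀ i, Measurable (f i))
    (hf0 : ∀ i, VanishesAtInfinity (f i)) (s : Finset ι) :
    Majorized (fun x => (∏ i ∈ s, ENNReal.ofReal (f i x)) * u x)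
      fun x => (∏ i ∈ s, symmRearrange (f i) x) * w x := by
  classical
  induction s using Finset.induction_on with
  | empty => simpa using huw
  | insert i s his ih =>
    simp only [Finset.prod_insert his, mul_assoc]
    exact ih.mul ((Finset.measurable_fun_prod s fun i _ => (hf i).ennreal_ofReal).mul hu)
      ((RadiallyDecreasing.prod fun i _ => radiallyDecreasing_symmRearrange (f i)).mul hw).measurable
      (hf i) (hf0 i)

theorem majorized_walkWeight [NeZero d] {ι : Type*}
    (f : ι → EuclideanSpace ℝ (Fin d) → ℝ) (hf : ∀ i, Measurable (f i))
    (hf0 : ∀ i, VanishesAtInfinity (f i)) {φ : EuclideanSpace ℝ (Fin d) → ℝ}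
    (hφ : Measurable φ) (hφ0 : VanishesAtInfinity φ) (K : ℕ) (s : ℕ → Finset ι) :
    Majorized
      (walkWeight K (fun n x => ∏ i ∈ s n, ENNReal.ofReal (f i x)) fun z => ENNReal.ofReal (φ z))
      (walkWeight K (fun n x => ∏ i ∈ s n, symmRearrange (f i) x) (symmRearrange φ)) := by
  have h1 : ∀ (s : ℕ → Finset ι) n, Measurable fun x => ∏ i ∈ s n, ENNReal.ofReal (f i x) :=
    fun s n => Finset.measurable_fun_prod _ fun i _ => (hf i).ennreal_ofReal
  have h2 : ∀ (s : ℕ → Finset ι) n,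
      RadiallyDecreasing fun x => ∏ i ∈ s n, symmRearrange (f i) x :=
    fun s n => RadiallyDecreasing.prod fun i _ => radiallyDecreasing_symmRearrange (f i)
  have h3 := radiallyDecreasing_symmRearrange φ
  induction K generalizing s with
  | zero =>
    rw [walkWeight_zero, walkWeight_zero]
    simpa using majorized_one.prod_mul measurable_one (fun _ _ _ => le_rfl) f hf hf0 (s 0)
  | succ K ih =>
    rw [walkWeight_succ K (h1 s) hφ.ennreal_ofReal,
      walkWeight_succ K (fun n => (h2 s n).measurable) h3.measurable]
    have hu := measurable_walkWeight K (h1 fun n => s (n + 1)) hφ.ennreal_ofReal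
    have hw := radiallyDecreasing_walkWeight K (h2 fun n => s (n + 1)) h3
    refine ((ih fun n => s (n + 1)).conv hu hw hφ hφ0).prod_mul ?_ (h3.conv hw) f hf hf0 (s 0)
    exact ((hφ.ennreal_ofReal.comp measurable_snd).mul
      (hu.comp (measurable_fst.add measurable_snd))).lintegral_prod_right'

theorem lintegral_walk_eq {ι : Type*} [Fintype ι] {g : ι → EuclideanSpace ℝ (Fin d) → ℝ≥0∞}
    (hg : ∀ i, Measurable (g i)) (hψ : Measurable ψ) {G : EuclideanSpace ℝ (Fin d) → ℝ≥0∞}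
    (hG : Measurable G) (k : ι → ℕ) :
    ∫⁻ p : EuclideanSpace ℝ (Fin d) × (Fin (Finset.univ.sup k) → EuclideanSpace ℝ (Fin d)),
        (∏ i, g i (p.1 + partialSum p.2 (k i))) * G p.1 * ∏ j, ψ (p.2 j) =
      ∫⁻ s, G s * walkWeight (Finset.univ.sup k)
        (fun n x => ∏ i with k i = n, g i x) ψ s := by
  have hh : ∀ n, Measurable fun x => ∏ i with k i = n, g i x :=
    fun n => Finset.measurable_fun_prod _ fun i _ => hg i
  have hm := measurable_walkWeight_integrand (K := Finset.univ.sup k)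
    (measurable_fst (α := EuclideanSpace ℝ (Fin d))) measurable_snd hh hψ
  have hgroup : ∀ p : EuclideanSpace ℝ (Fin d) ×
      (Fin (Finset.univ.sup k) → EuclideanSpace ℝ (Fin d)),
      ∏ i, g i (p.1 + partialSum p.2 (k i)) = ∏ n ∈ Finset.range (Finset.univ.sup k + 1),
        ∏ i with k i = n, g i (p.1 + partialSum p.2 n) := fun p => by
    rw [← Finset.prod_fiberwise_of_maps_to (s := Finset.univ) (g := k)
      (t := Finset.range (Finset.univ.sup k + 1))
      fun i hi => Finset.mem_range_succ_iff.2 (Finset.le_sup hi)]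
    refine Finset.prod_congr rfl fun n _ => Finset.prod_congr rfl fun i hi => ?_
    rw [(Finset.mem_filter.1 hi).2]
  calc _ = ∫⁻ p : EuclideanSpace ℝ (Fin d) × (Fin (Finset.univ.sup k) → EuclideanSpace ℝ (Fin d)),
        G p.1 * ((∏ n ∈ Finset.range (Finset.univ.sup k + 1),
          ∏ i with k i = n, g i (p.1 + partialSum p.2 n)) * ∏ j, ψ (p.2 j)) := by
        refine lintegral_congr fun p => ?_
        rw [hgroup]
        ring
    _ = _ := lintegral_prod_fst_mul hG hm

end Walk

section Gaussian

variable {d : ℕ}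

theorem ballStar_eq_ball [NeZero d] {S : Set (EuclideanSpace ℝ (Fin d))} {r : ℝ} (hr : 0 ≤ r)
    (h : volume S = volume (Metric.ball (0 : EuclideanSpace ℝ (Fin d)) r)) :
    ballStar S = Metric.ball 0 r := by
  rw [ballStar, symmRadius, h, volume_ball_zero hr, ENNReal.mul_div_cancel_right
    (Metric.measure_ball_pos _ _ one_pos).ne' measure_ball_lt_top.ne,
    ENNReal.toReal_ofReal (pow_nonneg hr d), one_div, Real.pow_rpow_inv_natCast hr (NeZero.ne d)]

theorem lt_mul_exp_iff {C a τ : ℝ} (hC : 0 < C) (ha : 0 < a) (hτ : 0 < τ)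
    (y : EuclideanSpace ℝ (Fin d)) :
    τ < C * Real.exp (-(‖y‖ ^ 2) / a) ↔ y ∈ Metric.ball 0 (√(a * Real.log (C / τ))) := by
  rw [mem_ball_zero_iff, Real.lt_sqrt (norm_nonneg y), ← div_lt_iff₀' hC,
    ← Real.log_lt_iff_lt_exp (div_pos hτ hC), ← inv_div C τ, Real.log_inv, neg_div, neg_lt_neg_iff,
    div_lt_iff₀' ha]

open scoped MatrixOrder in
theorem exists_linearMap_quadForm {M : Matrix (Fin d) (Fin d) ℝ} (hM : M.PosDef) :
    ∃ L : EuclideanSpace ℝ (Fin d) →ₗ[ℝ] EuclideanSpace ℝ (Fin d),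
      (∀ v, quadForm M v = ‖L v‖ ^ 2) ∧ |LinearMap.det L| = √M.det := by
  obtain ⟨B, rfl⟩ := CStarAlgebra.nonneg_iff_eq_star_mul_self.mp hM.posSemidef.nonneg
  refine ⟨B.toLpLin 2 2, fun v => ?_, ?_⟩
  · have h : quadForm (star B * B) v = v.ofLp ⬝ᵥ ((star B * B).mulVec v.ofLp) := by
      simp only [quadForm, dotProduct, Matrix.mulVec, Finset.mul_sum, mul_assoc]
    rw [h, ← Matrix.mulVec_mulVec, Matrix.dotProduct_mulVec, Matrix.star_eq_conjTranspose,
      Matrix.conjTranspose_eq_transpose_of_trivial, Matrix.vecMul_transpose,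
      EuclideanSpace.real_norm_sq_eq]
    simp [dotProduct, sq]
  · rw [LinearMap.det_toLpLin, Matrix.det_mul, Matrix.star_eq_conjTranspose,
      Matrix.conjTranspose_eq_transpose_of_trivial, Matrix.det_transpose, Real.sqrt_mul_self_eq_abs]

variable {A : Matrix (Fin d) (Fin d) ℝ} {t : ℝ}

theorem gaussConst_pos (hA : A.PosDef) (ht : 0 < t) :
    0 < (2 * Real.pi * t) ^ (-(d : ℝ) / 2) * (√A.det)⁻¹ := by
  have := hA.det_pos
  positivity

theorem lt_gaussStarDensity_iff (hA : A.PosDef) (ht : 0 < t) {τ : ℝ} (hτ : 0 < τ)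
    (y : EuclideanSpace ℝ (Fin d)) :
    τ < gaussStarDensity A t y ↔ y ∈ Metric.ball 0 (√(2 * t * A.det ^ ((1 : ℝ) / d) *
      Real.log ((2 * Real.pi * t) ^ (-(d : ℝ) / 2) * (√A.det)⁻¹ / τ))) := by
  have := hA.det_pos
  exact lt_mul_exp_iff (gaussConst_pos hA ht) (by positivity) hτ y

theorem volume_lt_gaussDensity [NeZero d] (hA : A.PosDef) (ht : 0 < t)
    (b x : EuclideanSpace ℝ (Fin d)) {τ : ℝ} (hτ : 0 < τ) :
    volume {y | τ < gaussDensity A b t (y - x)} = volume (Metric.ball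
      (0 : EuclideanSpace ℝ (Fin d)) (√(2 * t * A.det ^ ((1 : ℝ) / d) *
        Real.log ((2 * Real.pi * t) ^ (-(d : ℝ) / 2) * (√A.det)⁻¹ / τ)))) := by
  have hD := hA.det_pos
  obtain ⟨L, hL, hLdet⟩ := exists_linearMap_quadForm hA.inv
  have hdet : |LinearMap.det L| = (√A.det)⁻¹ := by
    rw [hLdet, Matrix.det_nonsing_inv, Ring.inverse_eq_inv', Real.sqrt_inv]
  have hdet0 : LinearMap.det L ≠ 0 := abs_ne_zero.1 (by rw [hdet]; positivity)
  set l := Real.log ((2 * Real.pi * t) ^ (-(d : ℝ) / 2) * (√A.det)⁻¹ / τ)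
  have hset : {y | τ < gaussDensity A b t (y - x)} =
      (fun y => y - (x + t • b)) ⁻¹' (L ⁻¹' Metric.ball 0 (√(2 * t * l))) := by
    ext y
    rw [Set.mem_preimage, Set.mem_preimage, ← lt_mul_exp_iff (gaussConst_pos hA ht)
      (by positivity) hτ, ← hL, ← sub_sub]
    rfl
  have hr : √(2 * t * A.det ^ ((1 : ℝ) / d) * l) ^ d = √A.det * √(2 * t * l) ^ d := by
    rw [mul_right_comm, mul_comm, Real.sqrt_mul (by positivity), mul_pow]
    congr 1
    rw [eq_comm, Real.sqrt_eq_iff_mul_self_eq hD.le (by positivity), ← mul_pow,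
      Real.mul_self_sqrt (by positivity), one_div, Real.rpow_inv_natCast_pow hD.le (NeZero.ne d)]
  simp_rw [hset, sub_eq_add_neg]
  rw [measure_preimage_add_right, Measure.addHaar_preimage_linearMap _ hdet0,
    volume_ball_zero (Real.sqrt_nonneg _), volume_ball_zero (Real.sqrt_nonneg _), hr, abs_inv, hdet,
    inv_inv, ENNReal.ofReal_mul (Real.sqrt_nonneg _), mul_assoc (ENNReal.ofReal _)]

theorem measurable_gaussDensity_sub (b x : EuclideanSpace ℝ (Fin d)) :
    Measurable fun y => gaussDensity A b t (y - x) := by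
  unfold gaussDensity quadForm
  fun_prop

theorem measurable_gaussStarDensity : Measurable (gaussStarDensity A t) := by
  unfold gaussStarDensity
  fun_prop

theorem vanishesAtInfinity_gaussDensity_sub [NeZero d] (hA : A.PosDef) (ht : 0 < t)
    (b x : EuclideanSpace ℝ (Fin d)) : VanishesAtInfinity fun y => gaussDensity A b t (y - x) :=
  fun _ hτ => (volume_lt_gaussDensity hA ht b x hτ).trans_lt measure_ball_lt_top

theorem symmRearrange_gaussDensity_sub [NeZero d] (hA : A.PosDef) (ht : 0 < t)
    (b x : EuclideanSpace ℝ (Fin d)) (s : EuclideanSpace ℝ (Fin d)) :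
    symmRearrange (fun y => gaussDensity A b t (y - x)) s =
      ENNReal.ofReal (gaussStarDensity A t s) := by
  rw [← lintegral_Ioi_indicator_ofReal_lt (ENNReal.ofReal (gaussStarDensity A t s))]
  refine setLIntegral_congr_fun measurableSet_Ioi fun τ (hτ : 0 < τ) => ?_
  have h : s ∈ ballStar {y | τ < gaussDensity A b t (y - x)} ↔
      τ ∈ {τ | ENNReal.ofReal τ < ENNReal.ofReal (gaussStarDensity A t s)} := by
    rw [ballStar_eq_ball (Real.sqrt_nonneg _) (volume_lt_gaussDensity hA ht b x hτ),
      ← lt_gaussStarDensity_iff hA ht hτ, Set.mem_ofPred_eq, ENNReal.ofReal_lt_ofReal_iff']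
    exact ⟨fun h => ⟨h, hτ.trans h⟩, And.left⟩
  by_cases hs : s ∈ ballStar {y | τ < gaussDensity A b t (y - x)}
  · rw [Set.indicator_of_mem hs, Set.indicator_of_mem (h.1 hs), Pi.one_apply]
  · rw [Set.indicator_of_notMem hs, Set.indicator_of_notMem (mt h.2 hs)]

end Gaussian

/-- **Rearrangement inequality for Gaussian-convolved random walks.**  The integration variable
is `p = (x₀, (x₁, …, x_{k_m}))`; for monotone `k` the quantity `Finset.univ.sup k` is `k_m`. -/
theorem gaussian_walk_rearrangement {d m : ℕ} (hd : 1 ≤ d) (hm : 1 ≤ m)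
    (A : Matrix (Fin d) (Fin d) ℝ) (hA : A.PosDef)
    (b : EuclideanSpace ℝ (Fin d)) (t : ℝ) (ht : 0 < t)
    (φ : EuclideanSpace ℝ (Fin d) → ℝ) (hφ_meas : Measurable φ)
    (hφ_nonneg : ∀ y, 0 ≤ φ y) (hφ_van : VanishesAtInfinity φ)
    (f : Fin m → EuclideanSpace ℝ (Fin d) → ℝ)
    (hf_cont : ∀ i, Continuous (f i))
    (hf_nonneg : ∀ i x, 0 ≤ f i x)
    (hf_van : ∀ i, VanishesAtInfinity (f i))
    (k : Fin m → ℕ) (hk_mono : Monotone k)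
    (x : EuclideanSpace ℝ (Fin d)) :
    (∫⁻ p : EuclideanSpace ℝ (Fin d) ×
        (Fin (Finset.univ.sup k) → EuclideanSpace ℝ (Fin d)),
        (∏ i, ENNReal.ofReal (f i (p.1 + partialSum p.2 (k i)))) *
          ENNReal.ofReal (gaussDensity A b t (p.1 - x)) *
          ∏ j, ENNReal.ofReal (φ (p.2 j))) ≤
      ∫⁻ p : EuclideanSpace ℝ (Fin d) ×
        (Fin (Finset.univ.sup k) → EuclideanSpace ℝ (Fin d)),
        (∏ i, symmRearrange (f i) (p.1 + partialSum p.2 (k i))) *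
          ENNReal.ofReal (gaussStarDensity A t p.1) *
          ∏ j, symmRearrange φ (p.2 j) := by
  have : NeZero d := ⟨by omega⟩
  have hf := fun i => (hf_cont i).measurable
  have hG := measurable_gaussDensity_sub (A := A) (t := t) b x
  have hφ := radiallyDecreasing_symmRearrange φ
  have hw : Measurable (walkWeight (Finset.univ.sup k)
      (fun n x => ∏ i with k i = n, symmRearrange (f i) x) (symmRearrange φ)) :=
    (radiallyDecreasing_walkWeight _ (fun n => RadiallyDecreasing.prod fun i _ =>
      radiallyDecreasing_symmRearrange (f i)) hφ).measurable
  rw [lintegral_walk_eq (fun i => (hf i).ennreal_ofReal) hφ_meas.ennreal_ofReal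
      hG.ennreal_ofReal k,
    lintegral_walk_eq (fun i => (radiallyDecreasing_symmRearrange (f i)).measurable)
      hφ.measurable measurable_gaussStarDensity.ennreal_ofReal k]
  simp_rw [← symmRearrange_gaussDensity_sub hA ht b x]
  exact (majorized_walkWeight f hf hf_van hφ_meas hφ_van _ _).lintegral_mul_le
    (measurable_walkWeight _ (fun n => Finset.measurable_fun_prod _ fun i _ =>
      (hf i).ennreal_ofReal) hφ_meas.ennreal_ofReal) hw hG
    (vanishesAtInfinity_gaussDensity_sub hA ht b x)
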